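/- arXiv:2206.10872 — 4 statements merged into one kernel-verified Lean document; each statement's English description precedes it below -/
import Mathlib

section
/- Let z and w be irreducible elements of S with z of type (C). Then the following are equivalent: (a) S/zS and S/wS are hull-similar; (b) T/zT and T/wT are isomorphic simple T-modules; (c) z and w are similar in T. When these equivalent statements hold, w is of type (C). -/
open MulOpposite

universe u

/-- `φ : R →+* S` and `θ : S` exhibit `S` as the skew polynomial ring `R[θ; α]`:
`θ · r = α(r) · θ`, and every element of `S` is uniquely a polynomial `Σ rᵢ θ^i`. -/
structure IsSkewPolynomialRing {R S : Type u} [CommRing R] [Ring S]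
    (α : R ≃+* R) (φ : R →+* S) (θ : S) : Prop where
  commutes : ∀ r : R, θ * φ r = φ (α r) * θ
  bijective : Function.Bijective fun p : ℕ →₀ R => p.sum fun n r => φ r * θ ^ n

/-- `ψ : S →+* T` exhibits `T` as the (Ore) localization of `S` inverting the
powers of the normal element `x`. -/
structure IsLocalizationAt {S T : Type u} [Ring S] [Ring T] (x : S) (ψ : S →+* T) : Prop where
  inj : Function.Injective ψ
  unit : IsUnit (ψ x)
  surj : ∀ t : T, ∃ (s : S) (n : ℕ), t * ψ x ^ n = ψ s

/-- The right ideal `zS`. -/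
abbrev rSpan (S : Type u) [Ring S] (z : S) : Submodule Sᵐᵒᵖ S := Submodule.span Sᵐᵒᵖ {z}

/-- The left ideal `Sz`. -/
abbrev lSpan (S : Type u) [Ring S] (z : S) : Submodule S S := Submodule.span S {z}

/-- The cyclic right `S`-module `S/zS`. -/
abbrev rQuot (S : Type u) [Ring S] (z : S) : Type u := S ⧸ rSpan S z

/-- The cyclic left `S`-module `S/Sz`. -/
abbrev lQuot (S : Type u) [Ring S] (z : S) : Type u := S ⧸ lSpan S z

/-- The cyclic right `S`-module `S/(aS + bS)`. -/
abbrev rQuot2 (S : Type u) [Ring S] (a b : S) : Type u := S ⧸ (rSpan S a ⊔ rSpan S b)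

/-- Two elements of `T` are similar if `T/aT ≅ T/bT` as right `T`-modules. -/
def SimilarIn (T : Type u) [Ring T] (a b : T) : Prop :=
  Nonempty (rQuot T a ≃ₗ[Tᵐᵒᵖ] rQuot T b)

/-- The image in `S` of a polynomial `p ∈ k[θ]`, i.e. `Σ φ(pᵢ) θ^i`. -/
def thetaPoly {k R S : Type u} [CommSemiring k] [CommRing R] [Ring S] [Algebra k R]
    (φ : R →+* S) (θ : S) (p : Polynomial k) : S :=
  p.sum fun n c => φ (algebraMap k R c) * θ ^ n

/-- Type (A) irreducibles of `S = R[θ; α]`: unit multiples of `X` or `θ`. -/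
def IsTypeA {R S : Type u} [CommRing R] [Ring S] (X : R) (φ : R →+* S) (θ : S) (z : S) : Prop :=
  ∃ u : Sˣ, (u : S) * z = φ X ∨ (u : S) * z = θ

/-- Type (B) irreducibles of `S = R[θ; α]`: unit multiples of `1 + Xs`, `s ∈ S∖R`. -/
def IsTypeB {R S : Type u} [CommRing R] [Ring S] (X : R) (φ : R →+* S) (z : S) : Prop :=
  ∃ (u : Sˣ) (s : S), s ∉ Set.range φ ∧ (u : S) * z = 1 + φ X * s

/-- Type (C) irreducibles of `S = R[θ; α]`: unit multiples of `f + Xs` with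
`f ∈ k[θ]∖k` monic and the element not equal to `θ`. -/
def IsTypeC (k : Type u) {R S : Type u} [CommSemiring k] [CommRing R] [Ring S] [Algebra k R]
    (X : R) (φ : R →+* S) (θ : S) (z : S) : Prop :=
  ∃ (u : Sˣ) (p : Polynomial k) (s : S), p.Monic ∧ 1 ≤ p.natDegree ∧
    (u : S) * z = thetaPoly φ θ p + φ X * s ∧ (u : S) * z ≠ θ

/-- A module is locally Artinian if all its finitely generated submodules are Artinian. -/
def IsLocallyArtinian (A M : Type u) [Ring A] [AddCommGroup M] [Module A M] : Prop :=
  ∀ N : Submodule A M, N.FG → IsArtinian A N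

/-- A submodule is essential if it meets every nonzero submodule nontrivially. -/
def IsEssentialSubmodule {A : Type u} [Ring A] {E : Type u} [AddCommGroup E] [Module A E]
    (U : Submodule A E) : Prop :=
  ∀ W : Submodule A E, W ≠ ⊥ → W ⊓ U ≠ ⊥

/-- `f : V →ₗ[A] E` exhibits `E` as an injective hull of `V`. -/
def IsInjectiveHullVia (A : Type u) [Ring A] {V E : Type u} [AddCommGroup V] [Module A V]
    [AddCommGroup E] [Module A E] (f : V →ₗ[A] E) : Prop :=
  Module.Injective A E ∧ Function.Injective f ∧ IsEssentialSubmodule (LinearMap.range f)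

/-- Property (◊) for left `A`-modules: the injective hull of every simple left `A`-module
is locally Artinian.  (Apply with `A = Sᵐᵒᵖ` for the right-module version.) -/
def HasDiamond (A : Type u) [Ring A] : Prop :=
  ∀ (V E : Type u) [AddCommGroup V] [Module A V] [AddCommGroup E] [Module A E]
    (f : V →ₗ[A] E), IsSimpleModule A V → IsInjectiveHullVia A f → IsLocallyArtinian A E

/-- Gabriel–Rentschler Krull dimension at most `n`; the base case `n = 0` is
`Artinian`, and `Kdim M ≤ n + 1` iff in every descending chain of submodules almost
all successive factors have Krull dimension at most `n`. -/
def KdimLE (A : Type u) [Ring A] : ℕ → ∀ (M : Type u) [AddCommGroup M] [Module A M], Prop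
  | 0, M, _, _ => IsArtinian A M
  | n + 1, M, _, _ =>
      ∀ f : ℕ → Submodule A M, (∀ i, f (i + 1) ≤ f i) →
        ∃ N : ℕ, ∀ i, N ≤ i →
          KdimLE A n (↥(f i) ⧸ Submodule.comap (f i).subtype (f (i + 1)))

/-- A `1`-critical module: Krull dimension exactly `1`, and all proper factors of
Krull dimension `< 1`, i.e. Artinian. -/
def IsOneCritical (A : Type u) [Ring A] (M : Type u) [AddCommGroup M] [Module A M] : Prop :=
  KdimLE A 1 M ∧ ¬ IsArtinian A M ∧ ∀ N : Submodule A M, N ≠ ⊥ → IsArtinian A (M ⧸ N)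

/-- A right `S`-module is `𝒳`-torsion free (`𝒳 = {xⁿ}`). -/
def IsXTorsionFree {S : Type u} [Ring S] (x : S) (M : Type u) [AddCommGroup M]
    [Module Sᵐᵒᵖ M] : Prop :=
  ∀ (m : M) (n : ℕ), op (x ^ n) • m = 0 → m = 0

/-- A right `S`-module is `𝒳`-torsion (`𝒳 = {xⁿ}`). -/
def IsXTorsion {S : Type u} [Ring S] (x : S) (M : Type u) [AddCommGroup M]
    [Module Sᵐᵒᵖ M] : Prop :=
  ∀ m : M, ∃ n : ℕ, op (x ^ n) • m = 0

/-- The central embedding of `k` into `Sᵐᵒᵖ` coming from `k → R → S`. -/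
def opScalars {k R S : Type u} [CommSemiring k] [CommRing R] [Ring S] [Algebra k R]
    (φ : R →+* S) : k →+* Sᵐᵒᵖ where
  toFun c := op (φ (algebraMap k R c))
  map_one' := by simp
  map_mul' x y := by
    show op (φ (algebraMap k R (x * y))) = op (φ (algebraMap k R x)) * op (φ (algebraMap k R y))
    rw [mul_comm x y, map_mul, map_mul, op_mul]
  map_zero' := by simp
  map_add' x y := by
    show op (φ (algebraMap k R (x + y))) = op (φ (algebraMap k R x)) + op (φ (algebraMap k R y))
    rw [map_add, map_add, op_add]

/-- A right `S`-module is finite dimensional over the central subfield `k`. -/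
def FinDimOver (k : Type u) {R S : Type u} [Field k] [CommRing R] [Ring S] [Algebra k R]
    (φ : R →+* S) (M : Type u) [AddCommGroup M] [Module Sᵐᵒᵖ M] : Prop :=
  letI : Module k M := Module.compHom M (opScalars φ)
  Module.Finite k M

/-- A left `S`-module is finite dimensional over the central subfield `k`. -/
def FinDimOverLeft (k : Type u) {R S : Type u} [Field k] [CommRing R] [Ring S] [Algebra k R]
    (φ : R →+* S) (M : Type u) [AddCommGroup M] [Module S M] : Prop :=
  letI : Module k M := Module.compHom M (φ.comp (algebraMap k R))
  Module.Finite k M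

/-- `Ext¹_A(U, V) = 0`: every short exact sequence `0 → V → Y → U → 0` splits. -/
def ExtVanish (A : Type u) [Ring A] (U V : Type u) [AddCommGroup U] [Module A U]
    [AddCommGroup V] [Module A V] : Prop :=
  ∀ (Y : Type u) [AddCommGroup Y] [Module A Y] (i : V →ₗ[A] Y) (p : Y →ₗ[A] U),
    Function.Injective i → Function.Surjective p → LinearMap.range i = LinearMap.ker p →
    ∃ r : Y →ₗ[A] V, r.comp i = LinearMap.id

/-- The right `S`-module `V` is isomorphic, as an `S`-module, to the right `T`-module `Q`
(`T` an `S`-ring via `ψ`). -/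
def SModIsoOfT {S T : Type u} [Ring S] [Ring T] (ψ : S →+* T)
    (V : Type u) [AddCommGroup V] [Module Sᵐᵒᵖ V]
    (Q : Type u) [AddCommGroup Q] [Module Tᵐᵒᵖ Q] : Prop :=
  ∃ e : V ≃+ Q, ∀ (s : S) (v : V), e (op s • v) = op (ψ s) • e v

/-- Two modules are hull-similar: they contain nonzero isomorphic submodules
(equivalently, their injective hulls are isomorphic). -/
def HullSimilar (A : Type u) [Ring A] (M N : Type u) [AddCommGroup M] [Module A M]
    [AddCommGroup N] [Module A N] : Prop :=
  ∃ (P : Submodule A M) (Q : Submodule A N), P ≠ ⊥ ∧ Q ≠ ⊥ ∧ Nonempty (P ≃ₗ[A] Q)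

/-- Restriction of scalars along `ψ : S →+* T` for right modules. -/
def restrictOp {S T : Type u} [Ring S] [Ring T] (ψ : S →+* T)
    (E : Type u) [AddCommGroup E] [Module Tᵐᵒᵖ E] : Module Sᵐᵒᵖ E :=
  Module.compHom E (RingHom.op ψ)

/-- `f : V →+ E` exhibits `E` as an injective hull of the `A`-module `V`,
where `f` is additionally required to be `A`-linear. -/
def IsInjectiveHullViaAdd (A : Type u) [Ring A] {V E : Type u} [AddCommGroup V] [Module A V]
    [AddCommGroup E] [Module A E] (f : V →+ E) : Prop :=
  Module.Injective A E ∧ Function.Injective f ∧ (∀ (a : A) (v : V), f (a • v) = a • f v) ∧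
    ∀ W : Submodule A E, W ≠ ⊥ → ∃ x : E, x ≠ 0 ∧ x ∈ W ∧ x ∈ Set.range f

namespace TypeC

section coeffs
variable {R S : Type u} [CommRing R] [Ring S] {α : R ≃+* R} {φ : R →+* S} {θ : S}

/-- The evaluation map `Σ rᵢ Yⁱ ↦ Σ φ(rᵢ) θⁱ`. -/
noncomputable def ev (φ : R →+* S) (θ : S) : (ℕ →₀ R) →+ S :=
  Finsupp.liftAddHom (fun n => (AddMonoidHom.mulRight (θ ^ n)).comp φ.toAddMonoidHom)

theorem ev_single (n : ℕ) (r : R) : ev φ θ (Finsupp.single n r) = φ r * θ ^ n := by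
  simp [ev]

theorem ev_bij (hS : IsSkewPolynomialRing α φ θ) : Function.Bijective (ev φ θ) := hS.bijective

/-- The coefficient map. -/
noncomputable def co (hS : IsSkewPolynomialRing α φ θ) : S ≃+ (ℕ →₀ R) :=
  (AddEquiv.ofBijective (ev φ θ) (ev_bij hS)).symm

theorem co_ev (hS : IsSkewPolynomialRing α φ θ) (p : ℕ →₀ R) : co hS (ev φ θ p) = p :=
  (AddEquiv.ofBijective (ev φ θ) (ev_bij hS)).symm_apply_apply p

theorem ev_co (hS : IsSkewPolynomialRing α φ θ) (s : S) : ev φ θ (co hS s) = s :=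
  (AddEquiv.ofBijective (ev φ θ) (ev_bij hS)).apply_symm_apply s

theorem pow_comm (hS : IsSkewPolynomialRing α φ θ) (n : ℕ) (r : R) :
    θ ^ n * φ r = φ (α^[n] r) * θ ^ n := by
  induction n generalizing r with
  | zero => simp
  | succ n ih =>
    rw [pow_succ, mul_assoc, hS.commutes, ← mul_assoc, ih, mul_assoc, Function.iterate_succ_apply]

theorem co_mul (hS : IsSkewPolynomialRing α φ θ) (s t : S) (n : ℕ) :
    co hS (s * t) n =
      ∑ ij ∈ Finset.HasAntidiagonal.antidiagonal n, co hS s ij.1 * α^[ij.1] (co hS t ij.2) := by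
  obtain ⟨p, rfl⟩ := (ev_bij hS).2 s
  obtain ⟨q, rfl⟩ := (ev_bij hS).2 t
  simp only [co_ev]
  induction p using Finsupp.induction_linear with
  | zero => simp
  | add f g hf hg =>
    simp only [map_add, add_mul, Finsupp.add_apply, hf, hg, Finset.sum_add_distrib]
  | single i a =>
    induction q using Finsupp.induction_linear with
    | zero => simp [iterate_map_zero]
    | add f g hf hg =>
      simp only [map_add, mul_add, Finsupp.add_apply, hf, hg, Finset.sum_add_distrib,
        iterate_map_add]
    | single j b =>
      have : ev φ θ (Finsupp.single i a) * ev φ θ (Finsupp.single j b)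
          = ev φ θ (Finsupp.single (i + j) (a * α^[i] b)) := by
        simp only [ev_single, map_mul]
        rw [mul_assoc, ← mul_assoc (θ ^ i), pow_comm hS, pow_add]
        simp only [mul_assoc]
      rw [this, co_ev]
      by_cases h : i + j = n
      · subst h
        rw [Finset.sum_eq_single (i, j)]
        · simp
        · rintro ⟨i', j'⟩ _ hne
          by_cases h1 : i = i'
          · by_cases h2 : j = j'
            · subst h1 h2; simp at hne
            · simp [Finsupp.single_apply, h2, iterate_map_zero]
          · simp [Finsupp.single_apply, h1]
        · simp
      · rw [Finsupp.single_apply, if_neg h]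
        symm
        apply Finset.sum_eq_zero
        rintro ⟨i', j'⟩ hm
        rw [Finset.HasAntidiagonal.mem_antidiagonal] at hm
        by_cases h1 : i = i'
        · by_cases h2 : j = j'
          · subst h1 h2; exact absurd hm h
          · simp [Finsupp.single_apply, h2, iterate_map_zero]
        · simp [Finsupp.single_apply, h1]

theorem co_phi (hS : IsSkewPolynomialRing α φ θ) (r : R) : co hS (φ r) = Finsupp.single 0 r := by
  have := co_ev hS (Finsupp.single 0 r)
  rwa [ev_single, pow_zero, mul_one] at this

theorem co_monom (hS : IsSkewPolynomialRing α φ θ) (n : ℕ) (r : R) :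
    co hS (φ r * θ ^ n) = Finsupp.single n r := by
  rw [← ev_single, co_ev]

/-- coefficients vanish above `n`. -/
def LE (hS : IsSkewPolynomialRing α φ θ) (n : ℕ) (s : S) : Prop := ∀ i, n < i → co hS s i = 0

theorem co_mul_top (hS : IsSkewPolynomialRing α φ θ) {m n : ℕ} {s t : S}
    (h1 : LE hS m s) (h2 : LE hS n t) :
    co hS (s * t) (m + n) = co hS s m * α^[m] (co hS t n) := by
  rw [co_mul, Finset.sum_eq_single (m, n)]
  · rintro ⟨i, j⟩ hm hne
    rw [Finset.HasAntidiagonal.mem_antidiagonal] at hm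
    simp only at hm ⊢
    rcases lt_trichotomy i m with h | h | h
    · rw [h2 j (by omega), iterate_map_zero, mul_zero]
    · exact absurd (Prod.ext h (by simp only; omega)) hne
    · rw [h1 i h, zero_mul]
  · simp

theorem LE_mul (hS : IsSkewPolynomialRing α φ θ) {m n : ℕ} {s t : S}
    (h1 : LE hS m s) (h2 : LE hS n t) : LE hS (m + n) (s * t) := by
  intro l hl
  rw [co_mul]
  apply Finset.sum_eq_zero
  rintro ⟨i, j⟩ hm
  rw [Finset.HasAntidiagonal.mem_antidiagonal] at hm
  simp only at hm ⊢
  by_cases h : m < i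
  · rw [h1 i h, zero_mul]
  · rw [h2 j (by omega), iterate_map_zero, mul_zero]

theorem exists_deg (hS : IsSkewPolynomialRing α φ θ) {s : S} (h : s ≠ 0) :
    ∃ n, LE hS n s ∧ co hS s n ≠ 0 := by
  have h0 : co hS s ≠ 0 := by simpa using h
  have hne : (co hS s).support.Nonempty := by simpa using h0
  refine ⟨(co hS s).support.max' hne, ?_, ?_⟩
  · intro i hi
    by_contra hc
    have := Finset.le_max' _ i (Finsupp.mem_support_iff.2 hc)
    omega
  · exact Finsupp.mem_support_iff.1 (Finset.max'_mem _ hne)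

theorem isDomain (hS : IsSkewPolynomialRing α φ θ) [IsDomain R] : IsDomain S := by
  haveI : Nontrivial S := by
    refine ⟨φ 1, 0, fun h => ?_⟩
    have := co_phi hS (1 : R)
    rw [h, map_zero] at this
    have h2 := DFunLike.congr_fun this 0
    simp at h2
  haveI : NoZeroDivisors S := by
    refine ⟨fun {a b} hab => ?_⟩
    by_contra! hc
    obtain ⟨m, hm, hm'⟩ := exists_deg hS hc.1
    obtain ⟨n, hn, hn'⟩ := exists_deg hS hc.2
    have := co_mul_top hS hm hn
    rw [hab, map_zero, Finsupp.zero_apply] at this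
    rcases mul_eq_zero.1 this.symm with h | h
    · exact hm' h
    · refine hn' (α.injective.iterate m ?_)
      rw [h, iterate_map_zero]
  exact NoZeroDivisors.to_isDomain S

/-- Pseudo-division. -/
theorem pdiv (hS : IsSkewPolynomialRing α φ θ) [IsDomain R] {a : S} {m : ℕ}
    (ha : LE hS m a) (ha' : co hS a m ≠ 0) (n : ℕ) :
    ∀ b : S, LE hS n b → ∃ (r : R) (c d : S), r ≠ 0 ∧ b * φ r = a * c + d ∧
      ∀ i, m ≤ i → co hS d i = 0 := by
  -- reduce to the case where all coefficients at index `≥ n` vanish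
  suffices H : ∀ n, ∀ b : S, (∀ i, n ≤ i → co hS b i = 0) → ∃ (r : R) (c d : S), r ≠ 0 ∧
      b * φ r = a * c + d ∧ ∀ i, m ≤ i → co hS d i = 0 from
    fun b hb => H (n + 1) b (fun i hi => hb i hi)
  intro n
  induction n with
  | zero => exact fun b hb => ⟨1, 0, b, one_ne_zero, by simp, fun i _ => hb i (Nat.zero_le _)⟩
  | succ n ih =>
    intro b hb
    by_cases hnm : n < m
    · exact ⟨1, 0, b, one_ne_zero, by simp, fun i hi => hb i (by omega)⟩
    obtain ⟨l, rfl⟩ : ∃ l, n = m + l := ⟨n - m, by omega⟩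
    obtain ⟨r, hr⟩ := (α.surjective.iterate (m + l)) (co hS a m)
    obtain ⟨c, hc⟩ := (α.surjective.iterate m) (co hS b (m + l))
    have hr0 : r ≠ 0 := by
      rintro rfl
      rw [iterate_map_zero] at hr
      exact ha' hr.symm
    have hbn : LE hS (m + l) b := fun i hi => hb i hi
    have hphi : LE hS 0 (φ r) := by
      intro i hi
      rw [co_phi, Finsupp.single_apply, if_neg (by omega)]
    have hmon : LE hS l (φ c * θ ^ l) := by
      intro i hi
      rw [co_monom, Finsupp.single_apply, if_neg (by omega)]
    obtain ⟨r', c', d, hr', hd, hd'⟩ := ih (b * φ r - a * (φ c * θ ^ l)) (by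
      intro i hi
      rw [map_sub, Finsupp.sub_apply]
      rcases hi.eq_or_lt with rfl | hi
      · have e1 := co_mul_top hS hbn hphi
        have e2 := co_mul_top hS ha hmon
        rw [add_zero] at e1
        rw [e1, e2, co_phi, co_monom, Finsupp.single_eq_same, Finsupp.single_eq_same, hr, hc]
        ring
      · rw [LE_mul hS hbn hphi i (by omega), LE_mul hS ha hmon i (by omega), sub_zero])
    refine ⟨r * r', φ c * θ ^ l * φ r' + c', d, mul_ne_zero hr0 hr', ?_, hd'⟩
    rw [map_mul, ← mul_assoc]
    rw [sub_mul, sub_eq_iff_eq_add] at hd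
    rw [hd, mul_add]
    noncomm_ring

end coeffs

section reduction
variable {k R S : Type u} [Field k] [CommRing R] [Ring S] {α : R ≃+* R} {φ : R →+* S} {θ : S}

/-- Reduction modulo `X`. -/
noncomputable def red (hS : IsSkewPolynomialRing α φ θ) (ρ : R →+* k)
    (hρ : ∀ r, ρ (α r) = ρ r) : S →+* Polynomial k :=
  have hit : ∀ n r, ρ (α^[n] r) = ρ r := by
    intro n
    induction n with
    | zero => simp
    | succ n ih => intro r; rw [Function.iterate_succ_apply, ih, hρ]
  let f : S → Polynomial k := fun s =>
    Polynomial.ofFinsupp (.ofCoeff (Finsupp.mapRange ρ (map_zero ρ) (co hS s)))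
  have hf : ∀ s n, (f s).coeff n = ρ (co hS s n) := fun s n => by simp [f, Polynomial.coeff]
  { toFun := f
    map_one' := by
      ext n
      rw [hf, ← map_one φ, co_phi, Polynomial.coeff_one, Finsupp.single_apply]
      by_cases h : n = 0
      · subst h; simp
      · rw [if_neg (Ne.symm h), if_neg h, map_zero]
    map_zero' := by ext n; rw [hf]; simp
    map_add' := fun s t => by ext n; rw [Polynomial.coeff_add, hf, hf, hf]; simp
    map_mul' := fun s t => by
      ext n
      rw [hf, co_mul, Polynomial.coeff_mul, map_sum]
      refine Finset.sum_congr rfl fun ij _ => ?_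
      rw [map_mul, hit, hf, hf] }

theorem red_coeff (hS : IsSkewPolynomialRing α φ θ) (ρ : R →+* k)
    (hρ : ∀ r, ρ (α r) = ρ r) (s : S) (n : ℕ) :
    (red hS ρ hρ s).coeff n = ρ (co hS s n) := by simp [red, Polynomial.coeff]

theorem co_phi_mul (hS : IsSkewPolynomialRing α φ θ) (r : R) (s : S) (n : ℕ) :
    co hS (φ r * s) n = r * co hS s n := by
  rw [co_mul, co_phi, Finset.sum_eq_single (0, n)]
  · simp
  · rintro ⟨i, j⟩ hm hne
    rw [Finset.HasAntidiagonal.mem_antidiagonal] at hm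
    have : i ≠ 0 := by rintro rfl; apply hne; ext <;> simp_all
    simp [Finsupp.single_apply, this.symm]
  · simp

theorem red_phi_eq (hS : IsSkewPolynomialRing α φ θ) (ρ : R →+* k)
    (hρ : ∀ r, ρ (α r) = ρ r) {X : R} (hX : ∀ r, ρ r = 0 ↔ ∃ t, r = X * t) (s : S) :
    red hS ρ hρ s = 0 ↔ ∃ t, s = φ X * t := by
  constructor
  · intro h
    have h1 : ∀ n, ∃ t, co hS s n = X * t := fun n => by
      rw [← hX, ← red_coeff hS ρ hρ, h, Polynomial.coeff_zero]
    classical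
    choose g hg using h1
    refine ⟨ev φ θ (Finsupp.onFinset (co hS s).support
      (fun n => if co hS s n = 0 then 0 else g n) (fun n hn => ?_)), ?_⟩
    · rw [Finsupp.mem_support_iff]; intro h0; simp [h0] at hn
    · apply (co hS).injective
      ext n
      rw [co_phi_mul, co_ev, Finsupp.onFinset_apply]
      split_ifs with h0
      · rw [h0, mul_zero]
      · exact hg n
  · rintro ⟨t, rfl⟩
    ext n
    rw [red_coeff, co_phi_mul, map_mul, (hX X).2 ⟨1, by simp⟩, zero_mul, Polynomial.coeff_zero]

theorem red_thetaPoly [Algebra k R] (hS : IsSkewPolynomialRing α φ θ) (ρ : R →+* k)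
    (hρ : ∀ r, ρ (α r) = ρ r) (hk : ∀ c, ρ (algebraMap k R c) = c) (p : Polynomial k) :
    red hS ρ hρ (thetaPoly φ θ p) = p := by
  rw [thetaPoly, Polynomial.sum, map_sum]
  conv_rhs => rw [p.as_sum_support]
  refine Finset.sum_congr rfl fun n _ => ?_
  ext i
  rw [red_coeff, co_monom, Polynomial.coeff_monomial, Finsupp.single_apply]
  split_ifs <;> simp [hk]

theorem normal (hS : IsSkewPolynomialRing α φ θ) {X q : R} (hq : IsUnit q) (hX : α X = X * q)
    (s : S) : (∃ t, s * φ X = φ X * t) ∧ (∃ t, φ X * s = t * φ X) := by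
  have key : ∀ n, ∃ v : R, IsUnit v ∧ α^[n] X = X * v := by
    intro n
    induction n with
    | zero => exact ⟨1, isUnit_one, by simp⟩
    | succ n ih =>
      obtain ⟨v, hv, e⟩ := ih
      refine ⟨q * α v, hq.mul (hv.map α), ?_⟩
      rw [Function.iterate_succ_apply', e, map_mul, hX, mul_assoc]
  obtain ⟨p, rfl⟩ := (ev_bij hS).2 s
  induction p using Finsupp.induction_linear with
  | zero => exact ⟨⟨0, by simp⟩, ⟨0, by simp⟩⟩
  | add f g hf hg =>
    obtain ⟨⟨a, ha⟩, ⟨b, hb⟩⟩ := hf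
    obtain ⟨⟨c, hc⟩, ⟨d, hd⟩⟩ := hg
    exact ⟨⟨a + c, by rw [map_add, add_mul, ha, hc, mul_add]⟩,
      ⟨b + d, by rw [map_add, mul_add, hb, hd, add_mul]⟩⟩
  | single n r =>
    obtain ⟨v, hv, e⟩ := key n
    obtain ⟨v', hv'⟩ := hv.exists_right_inv
    constructor
    · refine ⟨φ (r * v) * θ ^ n, ?_⟩
      rw [ev_single, mul_assoc, pow_comm hS, e, ← mul_assoc, ← mul_assoc, ← map_mul, ← map_mul]
      congr 2; ring
    · refine ⟨φ (r * v') * θ ^ n, ?_⟩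
      rw [ev_single, mul_assoc, pow_comm hS, e, ← mul_assoc, ← mul_assoc, ← map_mul, ← map_mul]
      congr 2
      linear_combination (-X * r) * hv'

end reduction

section abstract_part

theorem mem_rSpan {S : Type u} [Ring S] {z y : S} : y ∈ rSpan S z ↔ ∃ s, y = z * s := by
  rw [Submodule.mem_span_singleton]
  constructor
  · rintro ⟨a, rfl⟩; exact ⟨a.unop, rfl⟩
  · rintro ⟨a, rfl⟩; exact ⟨op a, rfl⟩

variable {S T A : Type u} [Ring S] [IsDomain S] [Ring T] [CommRing A] [IsDomain A]

/-- The working hypotheses. -/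
structure Ctx (x : S) (ψ : S →+* T) (π : S →+* A) : Prop where
  loc : IsLocalizationAt x ψ
  ker1 : ∀ s, π s = 0 ↔ ∃ t, s = x * t
  ker2 : ∀ s, π s = 0 ↔ ∃ t, s = t * x
  x0 : x ≠ 0
  prin : ∀ I : Submodule Tᵐᵒᵖ T, ∃ a : S, ∀ t, t ∈ I ↔ ∃ c, t = ψ a * c

variable {x : S} {ψ : S →+* T} {π : S →+* A}

theorem cancel (H : Ctx x ψ π) {z : S} (hz : π z ≠ 0) (n : ℕ) : ∀ s t, s * x ^ n = z * t → ∃ c, s = z * c := by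
  induction n with
  | zero => intro s t h; exact ⟨t, by simpa using h⟩
  | succ n ih =>
    intro s t h
    have : π t = 0 := by
      have h1 := congrArg π h
      rw [map_mul, map_mul, map_pow, (H.ker1 x).2 ⟨1, by simp⟩, pow_succ, mul_zero, mul_zero] at h1
      exact (mul_eq_zero.1 h1.symm).resolve_left hz
    obtain ⟨t', rfl⟩ := (H.ker2 t).1 this
    refine ih s t' (mul_right_cancel₀ H.x0 ?_)
    rw [mul_assoc, ← pow_succ, h, mul_assoc]

theorem contract (H : Ctx x ψ π) {z : S} (hz : π z ≠ 0) {s : S} {t : T} (h : ψ s = ψ z * t) :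
    ∃ c, s = z * c := by
  obtain ⟨s', n, hs⟩ := H.loc.surj t
  refine cancel H hz n s s' (H.loc.inj ?_)
  rw [map_mul, map_pow, h, mul_assoc, hs, map_mul]

theorem mem_iff (H : Ctx x ψ π) {z : S} (hz : π z ≠ 0) (s : S) : ψ s ∈ rSpan T (ψ z) ↔ s ∈ rSpan S z := by
  rw [mem_rSpan, mem_rSpan]
  constructor
  · rintro ⟨t, h⟩; exact contract H hz h
  · rintro ⟨c, rfl⟩; exact ⟨ψ c, map_mul _ _ _⟩

theorem factor (H : Ctx x ψ π) {z : S} (hz : Irreducible z) (n : ℕ) :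
    ∀ a s, z * x ^ n = a * s → IsUnit (ψ a) ∨ ∃ t, ψ a = ψ z * t := by
  induction n with
  | zero =>
    intro a s h
    rw [pow_zero, mul_one] at h
    rcases hz.isUnit_or_isUnit h with h1 | h1
    · exact Or.inl (h1.map ψ)
    · obtain ⟨c, hc⟩ := h1.exists_right_inv
      exact Or.inr ⟨ψ c, by rw [← map_mul, h, mul_assoc, hc, mul_one]⟩
  | succ n ih =>
    intro a s h
    have h1 := congrArg π h
    rw [map_mul, map_mul, map_pow, (H.ker1 x).2 ⟨1, by simp⟩, pow_succ, mul_zero, mul_zero] at h1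
    rcases mul_eq_zero.1 h1.symm with h2 | h2
    · obtain ⟨a', rfl⟩ := (H.ker2 a).1 h2
      obtain ⟨s', hs'⟩ := (H.ker2 (x * s)).1 ((H.ker1 _).2 ⟨s, rfl⟩)
      rcases ih a' s' (mul_right_cancel₀ H.x0 (by
        rw [mul_assoc, ← pow_succ, h, mul_assoc, hs', mul_assoc])) with h3 | ⟨t, h3⟩
      · left; rw [map_mul]; exact h3.mul H.loc.unit
      · right; exact ⟨t * ψ x, by rw [map_mul, h3, mul_assoc]⟩
    · obtain ⟨s', rfl⟩ := (H.ker2 s).1 h2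
      exact ih a s' (mul_right_cancel₀ H.x0 (by
        rw [mul_assoc, ← pow_succ, h, mul_assoc]))

theorem simple (H : Ctx x ψ π) {z : S} (hz : Irreducible z) (hz0 : π z ≠ 0) :
    IsSimpleModule Tᵐᵒᵖ (rQuot T (ψ z)) := by
  rw [isSimpleModule_iff_isCoatom]
  constructor
  · intro h
    have : ψ 1 ∈ rSpan T (ψ z) := by rw [h]; trivial
    rw [mem_iff H hz0, mem_rSpan] at this
    obtain ⟨c, hc⟩ := this
    exact hz.not_isUnit (IsUnit.of_mul_eq_one c hc.symm)
  · intro I hI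
    obtain ⟨a, ha⟩ := H.prin I
    have hzI : ψ z ∈ I := hI.le (Submodule.mem_span_singleton_self _)
    obtain ⟨c, hc⟩ := (ha _).1 hzI
    obtain ⟨s, n, hs⟩ := H.loc.surj c
    rcases factor H hz n a s (H.loc.inj (by
      rw [map_mul, map_pow, hc, mul_assoc, hs, map_mul])) with h | ⟨t, h⟩
    · rw [eq_top_iff]
      intro y _
      obtain ⟨b, hb⟩ := h.exists_right_inv
      exact (ha y).2 ⟨b * y, by rw [← mul_assoc, hb, one_mul]⟩
    · exfalso
      refine hI.not_ge fun y hy => ?_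
      obtain ⟨c', rfl⟩ := (ha y).1 hy
      exact mem_rSpan.2 ⟨t * c', by rw [h, mul_assoc]⟩

/-- An irreducible in the kernel generates `xS`. -/
theorem assoc_x (H : Ctx x ψ π) {w : S} (hw : Irreducible w) (h0 : π w = 0) :
    (∀ s, s * x ∈ rSpan S w) ∧ rSpan T (ψ w) = ⊤ := by
  obtain ⟨v, rfl⟩ := (H.ker1 w).1 h0
  have hv : IsUnit v := by
    refine (hw.isUnit_or_isUnit rfl).resolve_left fun hx => hw.not_isUnit ?_
    have : π 1 = 0 := by
      obtain ⟨y, hy⟩ := hx.exists_right_inv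
      exact (H.ker1 1).2 ⟨y, hy.symm⟩
    simp at this
  obtain ⟨v', hv'⟩ := hv.exists_right_inv
  constructor
  · intro s
    obtain ⟨t, ht⟩ := (H.ker1 (s * x)).1 ((H.ker2 _).2 ⟨s, rfl⟩)
    exact mem_rSpan.2 ⟨v' * t, by rw [ht, ← mul_assoc, mul_assoc x, hv', mul_one]⟩
  · rw [eq_top_iff]
    intro y _
    have : IsUnit (ψ (x * v)) := by rw [map_mul]; exact H.loc.unit.mul (hv.map ψ)
    obtain ⟨b, hb⟩ := this.exists_right_inv
    exact mem_rSpan.2 ⟨b * y, by rw [← mul_assoc, hb, one_mul]⟩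

end abstract_part

/-- The map `s ↦ a s + zS`. -/
def lmul {S : Type u} [Ring S] (z a : S) : S →ₗ[Sᵐᵒᵖ] rQuot S z where
  toFun s := Submodule.Quotient.mk (a * s)
  map_add' s t := by rw [mul_add]; rfl
  map_smul' r s := by
    show Submodule.Quotient.mk (a * (s * r.unop)) = _
    rw [← mul_assoc]; rfl

theorem lmul_apply {S : Type u} [Ring S] (z a s : S) :
    lmul z a s = op s • (Submodule.Quotient.mk a : rQuot S z) := rfl

theorem lmul_eq_zero {S : Type u} [Ring S] (z a s : S) :
    lmul z a s = 0 ↔ a * s ∈ rSpan S z := Submodule.Quotient.mk_eq_zero _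

theorem lmul_surj {T : Type u} [Ring T] (z a : T) (hs : IsSimpleModule Tᵐᵒᵖ (rQuot T z))
    (ha : a ∉ rSpan T z) : LinearMap.range (lmul z a) = ⊤ := by
  refine (eq_bot_or_eq_top _).resolve_left fun h => ha ?_
  have : lmul z a 1 ∈ LinearMap.range (lmul z a) := ⟨1, rfl⟩
  rw [h, Submodule.mem_bot, lmul_eq_zero, mul_one] at this
  exact this

section main_part
variable {S T A : Type u} [Ring S] [IsDomain S] [Ring T] [CommRing A] [IsDomain A]
variable {x : S} {ψ : S →+* T} {π : S →+* A}

theorem hull_notker (H : Ctx x ψ π) {z w : S} (hz0 : π z ≠ 0) (hw : Irreducible w)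
    (h : HullSimilar Sᵐᵒᵖ (rQuot S z) (rQuot S w)) : π w ≠ 0 := by
  intro h0
  obtain ⟨P, Q, hP, _, ⟨e⟩⟩ := h
  obtain ⟨m, hm, hm0⟩ := P.exists_mem_ne_zero_of_ne_bot hP
  have key : op x • (⟨m, hm⟩ : P) = 0 := by
    apply e.injective
    rw [map_smul, map_zero]
    apply Subtype.ext
    obtain ⟨b, hb⟩ := Submodule.Quotient.mk_surjective _ (e ⟨m, hm⟩ : rQuot S w)
    show op x • (e ⟨m, hm⟩ : rQuot S w) = 0
    rw [← hb, ← lmul_apply, lmul_eq_zero]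
    exact (assoc_x H hw h0).1 b
  have key2 : op x • m = 0 := congrArg Subtype.val key
  obtain ⟨a, rfl⟩ := Submodule.Quotient.mk_surjective _ m
  rw [← lmul_apply, lmul_eq_zero, mem_rSpan] at key2
  obtain ⟨t, ht⟩ := key2
  refine hm0 ((Submodule.Quotient.mk_eq_zero _).2 (mem_rSpan.2 ?_))
  exact cancel H hz0 1 a t (by simpa using ht)

theorem hull_iso (H : Ctx x ψ π) {z w : S} (hz : Irreducible z) (hw : Irreducible w)
    (hz0 : π z ≠ 0) (hw0 : π w ≠ 0)
    (h : HullSimilar Sᵐᵒᵖ (rQuot S z) (rQuot S w)) :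
    Nonempty (rQuot T (ψ z) ≃ₗ[Tᵐᵒᵖ] rQuot T (ψ w)) := by
  obtain ⟨P, Q, hP, _, ⟨e⟩⟩ := h
  obtain ⟨m, hm, hm0⟩ := P.exists_mem_ne_zero_of_ne_bot hP
  obtain ⟨b, hb⟩ := Submodule.Quotient.mk_surjective _ (e ⟨m, hm⟩ : rQuot S w)
  have hann : ∀ s : S, op s • m = 0 ↔ op s • (e ⟨m, hm⟩ : rQuot S w) = 0 := by
    intro s
    have h1 : op s • (⟨m, hm⟩ : P) = 0 ↔ op s • e ⟨m, hm⟩ = 0 := by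
      rw [← map_smul]; exact e.map_eq_zero_iff.symm
    rw [Subtype.ext_iff, Subtype.ext_iff] at h1
    exact h1
  obtain ⟨a, rfl⟩ := Submodule.Quotient.mk_surjective _ m
  rw [← hb] at hann
  simp only [← lmul_apply, lmul_eq_zero] at hann
  have ha : a ∉ rSpan S z := fun h => hm0 ((Submodule.Quotient.mk_eq_zero _).2 h)
  have hb' : b ∉ rSpan S w := fun h => ha (by
    have := (hann 1).2 (by rwa [mul_one])
    rwa [mul_one] at this)
  have hker : LinearMap.ker (lmul (ψ z) (ψ a)) = LinearMap.ker (lmul (ψ w) (ψ b)) := by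
    ext t
    rw [LinearMap.mem_ker, LinearMap.mem_ker, lmul_eq_zero, lmul_eq_zero]
    obtain ⟨s, n, hs⟩ := H.loc.surj t
    have aux : ∀ (z a : S), π z ≠ 0 → (ψ a * t ∈ rSpan T (ψ z) ↔ a * s ∈ rSpan S z) := by
      intro z a hz0
      rw [← mem_iff H hz0, map_mul, ← hs, ← mul_assoc]
      constructor
      · intro h; exact Submodule.smul_mem _ (op (ψ x ^ n)) h
      · intro h
        obtain ⟨y, hy⟩ := (H.loc.unit.pow n).exists_right_inv
        have := Submodule.smul_mem _ (op y) h
        rw [op_smul_eq_mul, mul_assoc, hy, mul_one] at this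
        exact this
    rw [aux z a hz0, aux w b hw0, hann]
  have e1 := LinearMap.quotKerEquivOfSurjective (lmul (ψ z) (ψ a))
    (LinearMap.range_eq_top.1 (lmul_surj _ _ (simple H hz hz0) (by rwa [mem_iff H hz0])))
  have e2 := LinearMap.quotKerEquivOfSurjective (lmul (ψ w) (ψ b))
    (LinearMap.range_eq_top.1 (lmul_surj _ _ (simple H hw hw0) (by rwa [mem_iff H hw0])))
  exact ⟨e1.symm.trans ((Submodule.quotEquivOfEq _ _ hker).trans e2)⟩

theorem iso_notker (H : Ctx x ψ π) {z w : S} (hz : Irreducible z) (hz0 : π z ≠ 0) (hw : Irreducible w)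
    (e : rQuot T (ψ z) ≃ₗ[Tᵐᵒᵖ] rQuot T (ψ w)) : π w ≠ 0 := by
  intro h0
  have hs := simple H hz hz0
  have : Nontrivial (rQuot T (ψ z)) := IsSimpleModule.nontrivial Tᵐᵒᵖ _
  have h2 := e.toEquiv.symm.nontrivial
  exact (Submodule.Quotient.nontrivial_iff.1 h2) (assoc_x H hw h0).2

theorem iso_hull (H : Ctx x ψ π) {z w : S} (hz : Irreducible z)
    (hz0 : π z ≠ 0) (hw0 : π w ≠ 0)
    (e : rQuot T (ψ z) ≃ₗ[Tᵐᵒᵖ] rQuot T (ψ w)) :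
    HullSimilar Sᵐᵒᵖ (rQuot S z) (rQuot S w) := by
  obtain ⟨t, ht⟩ := Submodule.Quotient.mk_surjective _ (e (Submodule.Quotient.mk 1))
  obtain ⟨s, n, hs⟩ := H.loc.surj t
  have hs1 : e (Submodule.Quotient.mk (ψ (x ^ n))) = Submodule.Quotient.mk (ψ s) := by
    have : (Submodule.Quotient.mk (ψ (x ^ n)) : rQuot T (ψ z))
        = op (ψ x ^ n) • Submodule.Quotient.mk 1 := by
      rw [← lmul_apply]
      show _ = Submodule.Quotient.mk (1 * _)
      rw [one_mul, map_pow]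
    rw [this, map_smul, ← ht, ← hs]; rfl
  have hann : ∀ r, x ^ n * r ∈ rSpan S z ↔ s * r ∈ rSpan S w := by
    intro r
    rw [← mem_iff H hz0, ← mem_iff H hw0, map_mul, map_mul, ← lmul_eq_zero, ← lmul_eq_zero,
      lmul_apply, lmul_apply, ← hs1, ← map_smul, e.map_eq_zero_iff]
  have hxn : x ^ n ∉ rSpan S z := by
    intro h
    rw [mem_rSpan] at h
    obtain ⟨c, hc⟩ := h
    obtain ⟨c', hc'⟩ := cancel H hz0 n 1 c (by simpa using hc)
    exact hz.not_isUnit (IsUnit.of_mul_eq_one c' hc'.symm)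
  have hsw : s ∉ rSpan S w := fun h => hxn (by
    have := (hann 1).2 (by rwa [mul_one])
    rwa [mul_one] at this)
  have hker : LinearMap.ker (lmul z (x ^ n)) = LinearMap.ker (lmul w s) := by
    ext r
    rw [LinearMap.mem_ker, LinearMap.mem_ker, lmul_eq_zero, lmul_eq_zero, hann]
  have hne : ∀ (z a : S), a ∉ rSpan S z → LinearMap.range (lmul z a) ≠ ⊥ := by
    intro z a ha h
    have : lmul z a 1 ∈ LinearMap.range (lmul z a) := ⟨1, rfl⟩
    rw [h, Submodule.mem_bot, lmul_eq_zero, mul_one] at this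
    exact ha this
  exact ⟨_, _, hne _ _ hxn, hne _ _ hsw, ⟨(LinearMap.quotKerEquivRange _).symm.trans
    ((Submodule.quotEquivOfEq _ _ hker).trans (LinearMap.quotKerEquivRange _))⟩⟩

theorem iso_unit (H : Ctx x ψ π) {z w : S} (hz0 : π z ≠ 0) 
    (hwu : ∃ a b, w * a + b * x = 1)
    (e : rQuot T (ψ z) ≃ₗ[Tᵐᵒᵖ] rQuot T (ψ w)) : IsUnit (π z) := by
  -- powers of `x` are normal
  have hnorm : ∀ n s, ∃ t, s * x ^ n = x ^ n * t := by
    intro n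
    induction n with
    | zero => intro s; exact ⟨s, by simp⟩
    | succ n ih =>
      intro s
      obtain ⟨t, ht⟩ := ih s
      obtain ⟨t', ht'⟩ := (H.ker1 (t * x)).1 ((H.ker2 _).2 ⟨t, rfl⟩)
      exact ⟨t', by rw [pow_succ, ← mul_assoc, ht, mul_assoc, ht', ← mul_assoc]⟩
  -- `S = wS + S xⁿ`
  have hdiv : ∀ n s, ∃ a b, w * a + b * x ^ n = s := by
    intro n
    induction n with
    | zero => intro s; exact ⟨0, s, by simp⟩
    | succ n ih =>
      intro s
      obtain ⟨a, b, h⟩ := ih s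
      obtain ⟨c, d, hcd⟩ := hwu
      -- `b = w c b + d x b`
      obtain ⟨b', hb'⟩ := (H.ker2 (x * b)).1 ((H.ker1 _).2 ⟨b, rfl⟩)
      refine ⟨a + c * b * x ^ n, d * b', ?_⟩
      have h1 : b = w * (c * b) + d * b' * x := by
        rw [mul_assoc d, ← hb', ← mul_assoc, ← mul_assoc, ← add_mul, hcd, one_mul]
      have h2 : w * (c * b) * x ^ n + d * b' * x * x ^ n = b * x ^ n := by
        rw [← add_mul, ← h1]
      rw [← h, ← h2, mul_add, pow_succ']
      simp only [mul_assoc, add_assoc]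
  have hrep : ∀ y : rQuot T (ψ w), ∃ s : S, y = Submodule.Quotient.mk (ψ s) := by
    intro y
    obtain ⟨t, rfl⟩ := Submodule.Quotient.mk_surjective _ y
    obtain ⟨s, n, hs⟩ := H.loc.surj t
    obtain ⟨a, b, hab⟩ := hdiv n s
    refine ⟨b, (Submodule.Quotient.eq _).2 (mem_rSpan.2 ?_)⟩
    obtain ⟨y, hy⟩ := (H.loc.unit.pow n).exists_right_inv
    refine ⟨ψ a * y, ?_⟩
    have h1 : t = t * ψ x ^ n * y := by rw [mul_assoc, hy, mul_one]
    rw [h1, hs, ← hab, map_add, map_mul, map_mul, map_pow, add_mul, mul_assoc (ψ b), hy, mul_one,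
      add_sub_cancel_right, mul_assoc]
  obtain ⟨v, hv⟩ := Submodule.Quotient.mk_surjective _ (e.symm (Submodule.Quotient.mk 1))
  obtain ⟨s0, N, hs0⟩ := H.loc.surj v
  obtain ⟨y, hy⟩ := H.loc.unit.exists_left_inv
  obtain ⟨yN, hyN⟩ := (H.loc.unit.pow N).exists_left_inv
  obtain ⟨s, hs⟩ := hrep (e (Submodule.Quotient.mk (y * yN)))
  have h1 : (Submodule.Quotient.mk (y * yN) : rQuot T (ψ z)) = Submodule.Quotient.mk (v * ψ s) := by
    apply e.injective
    rw [hs]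
    have : (Submodule.Quotient.mk (v * ψ s) : rQuot T (ψ z))
        = op (ψ s) • Submodule.Quotient.mk v := rfl
    rw [this, map_smul, hv, e.apply_symm_apply]
    show _ = Submodule.Quotient.mk (1 * ψ s)
    rw [one_mul]
  rw [Submodule.Quotient.eq, mem_rSpan] at h1
  obtain ⟨c, hc⟩ := h1
  obtain ⟨s', hs'⟩ := hnorm N s
  have h2 : ψ (1 - s0 * s' * x) = ψ z * (c * ψ x ^ N * ψ x) := by
    have h3 : (y * yN - v * ψ s) * ψ x ^ N * ψ x = 1 - ψ s0 * ψ s' * ψ x := by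
      have h4 : ψ s * ψ x ^ N = ψ x ^ N * ψ s' := by
        rw [← map_pow, ← map_mul, hs', map_mul]
      rw [sub_mul, sub_mul, mul_assoc y, hyN, mul_one, hy, mul_assoc v, h4, ← mul_assoc, hs0]
    rw [map_sub, map_one, map_mul, map_mul, ← h3, hc]
    simp only [mul_assoc]
  obtain ⟨d, hd⟩ := contract H hz0 h2
  have h5 := congrArg π hd
  rw [map_sub, map_one, map_mul, (H.ker1 x).2 ⟨1, by simp⟩, mul_zero, sub_zero, map_mul] at h5
  exact IsUnit.of_mul_eq_one _ h5.symm

end main_part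

end TypeC

/-- Let `z` and `w` be irreducible elements of `S` with `z` of type
(C).  Then the following are equivalent: (a) `S/zS` and `S/wS` are hull-similar;
(b) `T/zT` and `T/wT` are isomorphic simple `T`-modules; (c) `z` and `w` are similar in
`T`.  When these hold, `w` is of type (C). -/
theorem typeC_hull_similarity_criterion
    {k : Type u} [Field k]
    {R : Type u} [CommRing R] [IsDomain R] [IsDiscreteValuationRing R] [Algebra k R]
    (X : R) (hX : IsLocalRing.maximalIdeal R = Ideal.span {X})
    (hres : Function.Bijective ((IsLocalRing.residue R).comp (algebraMap k R)))
    (α : R ≃ₐ[k] R) (hord : ∀ n : ℕ, 0 < n → α ^ n ≠ 1)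
    {S : Type u} [Ring S] (φ : R →+* S) (θ : S)
    (hS : IsSkewPolynomialRing α.toRingEquiv φ θ)
    {T : Type u} [Ring T] (ψ : S →+* T) (hT : IsLocalizationAt (φ X) ψ)
    (z w : S) (hz : Irreducible z) (hzC : IsTypeC k X φ θ z) (hw : Irreducible w) :
    (HullSimilar Sᵐᵒᵖ (rQuot S z) (rQuot S w) ↔
      (IsSimpleModule Tᵐᵒᵖ (rQuot T (ψ z)) ∧ IsSimpleModule Tᵐᵒᵖ (rQuot T (ψ w)) ∧
        Nonempty (rQuot T (ψ z) ≃ₗ[Tᵐᵒᵖ] rQuot T (ψ w)))) ∧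
    ((IsSimpleModule Tᵐᵒᵖ (rQuot T (ψ z)) ∧ IsSimpleModule Tᵐᵒᵖ (rQuot T (ψ w)) ∧
        Nonempty (rQuot T (ψ z) ≃ₗ[Tᵐᵒᵖ] rQuot T (ψ w))) ↔ SimilarIn T (ψ z) (ψ w)) ∧
    (HullSimilar Sᵐᵒᵖ (rQuot S z) (rQuot S w) → IsTypeC k X φ θ w) := by
  haveI : IsDomain S := TypeC.isDomain hS
  have hX0 : X ≠ 0 := by
    rintro rfl
    exact IsDiscreteValuationRing.not_a_field R (by simpa using hX)
  -- the residue map to `k`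
  let ek : k ≃+* IsLocalRing.ResidueField R := RingEquiv.ofBijective _ hres
  let ρ : R →+* k := (ek.symm : IsLocalRing.ResidueField R →+* k).comp (IsLocalRing.residue R)
  have hk : ∀ c, ρ (algebraMap k R c) = c := fun c => ek.symm_apply_apply c
  have hker : ∀ r, ρ r = 0 ↔ ∃ t, r = X * t := by
    intro r
    have h1 : ρ r = 0 ↔ IsLocalRing.residue R r = 0 := ek.symm.map_eq_zero_iff
    rw [h1, IsLocalRing.residue_eq_zero_iff, hX, Ideal.mem_span_singleton]
    rfl
  have hunit : ∀ r, ρ r ≠ 0 → IsUnit r := by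
    intro r hr
    by_contra hc
    apply hr
    rw [hker, ← dvd_def, ← Ideal.mem_span_singleton, ← hX]
    exact hc
  have hmem : ∀ r, ρ r = 0 → ρ (α r) = 0 := by
    intro r hr
    by_contra hc
    have h1 := (hunit _ hc).map α.symm
    rw [AlgEquiv.symm_apply_apply] at h1
    exact (h1.map ρ).ne_zero hr
  have hρ : ∀ r, ρ (α.toRingEquiv r) = ρ r := by
    intro r
    have h1 : ρ (r - algebraMap k R (ρ r)) = 0 := by rw [map_sub, hk, sub_self]
    have h2 := hmem _ h1
    rw [map_sub, AlgEquiv.commutes, map_sub, hk, sub_eq_zero] at h2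
    exact h2
  obtain ⟨q, hq⟩ := (hker (α X)).1 (hmem _ ((hker X).2 ⟨1, by simp⟩))
  have hqu : IsUnit q := by
    have h1 : ρ (α.symm X) = 0 := by
      by_contra hc
      have h1 := (hunit _ hc).map α
      rw [AlgEquiv.apply_symm_apply] at h1
      exact (h1.map ρ).ne_zero ((hker X).2 ⟨1, by simp⟩)
    obtain ⟨q', hq'⟩ := (hker _).1 h1
    have h2 := congrArg α hq'
    rw [AlgEquiv.apply_symm_apply, map_mul, hq, mul_assoc] at h2
    refine IsUnit.of_mul_eq_one (α q') (mul_left_cancel₀ hX0 ?_)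
    rw [← h2, mul_one]
  have hnorm := TypeC.normal hS hqu (show α.toRingEquiv X = X * q from hq)
  let π := TypeC.red hS ρ hρ
  have hπ1 := TypeC.red_phi_eq hS ρ hρ hker
  have hXirr : Irreducible X :=
    (IsDiscreteValuationRing.irreducible_iff_uniformizer X).2 hX
  have hRu : ∀ r : R, r ≠ 0 → IsUnit (ψ (φ r)) := by
    intro r hr
    obtain ⟨n, u, rfl⟩ := IsDiscreteValuationRing.eq_unit_mul_pow_irreducible hr hXirr
    rw [map_mul, map_mul, map_pow, map_pow]
    exact ((u.isUnit.map φ).map ψ).mul (hT.unit.pow n)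
  have H : TypeC.Ctx (φ X) ψ π := by
    refine ⟨hT, hπ1, ?_, ?_, ?_⟩
    · intro s
      rw [hπ1]
      constructor
      · rintro ⟨t, rfl⟩; exact (hnorm t).2
      · rintro ⟨t, rfl⟩; exact (hnorm t).1
    · intro h
      have h1 := TypeC.co_phi hS X
      rw [h, map_zero] at h1
      have h2 := DFunLike.congr_fun h1 0
      rw [Finsupp.single_eq_same] at h2
      exact hX0 h2.symm
    · intro I
      by_cases hI : ∃ n, ∃ a : S, ψ a ∈ I ∧ TypeC.LE hS n a ∧ TypeC.co hS a n ≠ 0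
      · classical
        obtain ⟨a, haI, ha, ha'⟩ := Nat.find_spec hI
        have hmin := fun m (hm : m < Nat.find hI) => Nat.find_min hI hm
        set m := Nat.find hI with hm
        refine ⟨a, fun t => ⟨fun ht => ?_, ?_⟩⟩
        · obtain ⟨b, n, hb⟩ := hT.surj t
          have hbI : ψ b ∈ I := by rw [← hb]; exact I.smul_mem (op (ψ (φ X) ^ n)) ht
          have hdeg : ∃ l, TypeC.LE hS l b := by
            by_cases hb0 : b = 0
            · exact ⟨0, fun i _ => by simp [hb0]⟩
            · obtain ⟨l, hl, _⟩ := TypeC.exists_deg hS hb0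
              exact ⟨l, hl⟩
          obtain ⟨l, hl⟩ := hdeg
          obtain ⟨r, c, d, hr, hd, hd'⟩ := TypeC.pdiv hS ha ha' l b hl
          have hdI : ψ d ∈ I := by
            have : ψ d = ψ b * ψ (φ r) - ψ a * ψ c := by
              rw [← map_mul, hd, map_add, map_mul, add_sub_cancel_left]
            rw [this]
            exact I.sub_mem (I.smul_mem (op (ψ (φ r))) hbI) (I.smul_mem (op (ψ c)) haI)
          have hd0 : d = 0 := by
            by_contra hd0
            obtain ⟨j, hj, hj'⟩ := TypeC.exists_deg hS hd0
            have hjm : j < m := by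
              by_contra hjm
              exact hj' (hd' j (by omega))
            exact hmin j hjm ⟨d, hdI, hj, hj'⟩
          rw [hd0, add_zero] at hd
          have hu := (hT.unit.pow n).mul (hRu r hr)
          obtain ⟨y, hy⟩ := hu.exists_right_inv
          refine ⟨ψ c * y, ?_⟩
          have : t * (ψ (φ X) ^ n * ψ (φ r)) = ψ a * ψ c := by
            rw [← mul_assoc, hb, ← map_mul, hd, map_mul]
          rw [← mul_assoc, ← this, mul_assoc, hy, mul_one]
        · rintro ⟨c, rfl⟩
          exact I.smul_mem (op c) haI
      · refine ⟨0, fun t => ⟨fun ht => ⟨0, ?_⟩, ?_⟩⟩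
        · obtain ⟨b, n, hb⟩ := hT.surj t
          have hbI : ψ b ∈ I := by rw [← hb]; exact I.smul_mem (op (ψ (φ X) ^ n)) ht
          have hb0 : b = 0 := by
            by_contra hb0
            obtain ⟨l, hl, hl'⟩ := TypeC.exists_deg hS hb0
            exact hI ⟨l, b, hbI, hl, hl'⟩
          rw [hb0, map_zero] at hb
          rw [mul_zero]
          exact (hT.unit.pow n).mul_left_eq_zero.1 hb
        · rintro ⟨c, rfl⟩
          rw [map_zero, zero_mul]
          exact I.zero_mem
  -- `z` reduces to a polynomial of positive degree
  have hzdeg : 1 ≤ (π z).natDegree := by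
    obtain ⟨u, p, s, hp, hp1, huz, _⟩ := hzC
    have h1 : π u * π z = p := by
      rw [← map_mul, huz, map_add, (hπ1 (φ X * s)).2 ⟨s, rfl⟩, add_zero]
      exact TypeC.red_thetaPoly hS ρ hρ hk p
    have h2 : IsUnit (π u) := u.isUnit.map π
    have hz0 : π z ≠ 0 := by
      intro h
      rw [h, mul_zero] at h1
      exact hp.ne_zero h1.symm
    rw [← h1, Polynomial.natDegree_mul h2.ne_zero hz0,
      Polynomial.natDegree_eq_zero_of_isUnit h2, zero_add] at hp1
    exact hp1
  have hz0 : π z ≠ 0 := by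
    intro h
    rw [h, Polynomial.natDegree_zero] at hzdeg
    omega
  have hzs := TypeC.simple H hz hz0
  have hcb : SimilarIn T (ψ z) (ψ w) → (IsSimpleModule Tᵐᵒᵖ (rQuot T (ψ z)) ∧
      IsSimpleModule Tᵐᵒᵖ (rQuot T (ψ w)) ∧
        Nonempty (rQuot T (ψ z) ≃ₗ[Tᵐᵒᵖ] rQuot T (ψ w))) := by
    rintro ⟨e⟩
    exact ⟨hzs, IsSimpleModule.congr e.symm, ⟨e⟩⟩
  refine ⟨⟨fun h => hcb ?_, ?_⟩, ⟨fun h => h.2.2, hcb⟩, ?_⟩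
  · exact TypeC.hull_iso H hz hw hz0 (TypeC.hull_notker H hz0 hw h) h
  · rintro ⟨_, _, ⟨e⟩⟩
    exact TypeC.iso_hull H hz hz0 (TypeC.iso_notker H hz hz0 hw e) e
  · intro h
    have hw0 := TypeC.hull_notker H hz0 hw h
    obtain ⟨e⟩ := TypeC.hull_iso H hz hw hz0 hw0 h
    have hwdeg : 1 ≤ (π w).natDegree := by
      by_contra hc
      have hc0 : (π w).natDegree = 0 := by omega
      have hwu : IsUnit (π w) := by
        rw [Polynomial.eq_C_of_natDegree_eq_zero hc0] at hw0 ⊢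
        exact Polynomial.isUnit_C.2 (isUnit_iff_ne_zero.2 (by simpa using hw0))
      obtain ⟨y, hy⟩ := hwu.exists_right_inv
      have h1 : π (1 - w * thetaPoly φ θ y) = 0 := by
        have h2 : π (thetaPoly φ θ y) = y := TypeC.red_thetaPoly hS ρ hρ hk y
        rw [map_sub, map_one, map_mul, h2, hy, sub_self]
      obtain ⟨b, hb⟩ := (H.ker2 _).1 h1
      have h3 := TypeC.iso_unit H hz0 ⟨thetaPoly φ θ y, b, by rw [← hb]; abel⟩ e
      have := Polynomial.natDegree_eq_zero_of_isUnit h3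
      omega
    -- normalise `w`
    have hlc : (π w).leadingCoeff ≠ 0 := Polynomial.leadingCoeff_ne_zero.2 hw0
    let u0 : kˣ := (Units.mk0 _ hlc)⁻¹
    let u : Sˣ := Units.map (φ.comp (algebraMap k R) : k →* S) u0
    have hu : (u : S) = φ (algebraMap k R (π w).leadingCoeff⁻¹) := by simp [u, u0]
    let p : Polynomial k := Polynomial.C (π w).leadingCoeff⁻¹ * π w
    have hpm : p.Monic := by
      rw [Polynomial.Monic, Polynomial.leadingCoeff_mul, Polynomial.leadingCoeff_C,
        inv_mul_cancel₀ hlc]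
    have hpd : 1 ≤ p.natDegree := by
      rw [Polynomial.natDegree_C_mul (inv_ne_zero hlc)]; exact hwdeg
    have hred : π (u * w) = p := by
      ext n
      rw [hu, Polynomial.coeff_C_mul]
      rw [TypeC.red_coeff, TypeC.co_phi_mul, map_mul, hk, TypeC.red_coeff]
    have hdiff : ∃ s, u * w = thetaPoly φ θ p + φ X * s := by
      have h2 : π (thetaPoly φ θ p) = p := TypeC.red_thetaPoly hS ρ hρ hk p
      obtain ⟨s, hs⟩ := (hπ1 (u * w - thetaPoly φ θ p)).1 (by
        show π _ = 0
        rw [map_sub, hred, h2, sub_self])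
      exact ⟨s, by rw [← hs]; abel⟩
    obtain ⟨s, hs⟩ := hdiff
    by_cases hθ : (u : S) * w = θ
    · -- replace `u` by `(1 + X) u`
      have h1X : IsUnit (1 + X) := hunit _ (by
        rw [map_add, map_one, (hker X).2 ⟨1, by simp⟩, add_zero]; exact one_ne_zero)
      obtain ⟨v, hv⟩ := h1X.map φ
      refine ⟨v * u, p, s + θ, hpm, hpd, ?_, ?_⟩
      · rw [Units.val_mul, mul_assoc, hv, map_add, map_one, add_mul, one_mul, mul_add,
          ← add_assoc, ← hs, hθ]
      · rw [Units.val_mul, mul_assoc, hv, hθ, map_add, map_one, add_mul, one_mul]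
        intro h0
        have h1 : φ X * θ = 0 := by simpa using h0
        rcases mul_eq_zero.1 h1 with h2 | h2
        · exact H.x0 h2
        · rw [h2, mul_eq_zero] at hθ
          rcases hθ with h3 | h3
          · exact u.ne_zero h3
          · exact hw.ne_zero h3
    · exact ⟨u, p, s, hpm, hpd, hs, hθ⟩
end

section
/- Let E be an indecomposable injective right S-module whose 𝒳-torsion submodule is nonzero. Then E is 𝒳-torsion and one of the following holds: (1) E = E_S(S/XS), and E is an infinite ascending union of submodules Ann_E(X^n S) (n ≥ 1) with each factor Ann_E(X^{n+1}S)/Ann_E(X^n S) isomorphic as S/XS ≅ k[θ]-module to the rational function field k(θ); or (2) E = E_S(S/(XS + p(θ)S)) for some irreducible polynomial p(θ) ∈ k[θ], and E is locally finite dimensional over k. -/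
open MulOpposite

universe u

theorem aux_exists_max_disj {A : Type u} [Ring A] {E : Type u} [AddCommGroup E] [Module A E]
    (U B : Submodule A E) (h : Disjoint B U) :
    ∃ C, B ≤ C ∧ Disjoint C U ∧ ∀ D, C ≤ D → Disjoint D U → D = C := by
  obtain ⟨C, hBC, hC⟩ := zorn_le_nonempty₀ {C : Submodule A E | Disjoint C U} (by
    intro c hc hchain y hy
    refine ⟨sSup c, ?_, fun z hz => le_sSup hz⟩
    exact (DirectedOn.disjoint_sSup_left hchain.directedOn).2 (fun z hz => hc hz)) B h
  exact ⟨C, hBC, hC.prop, fun D hCD hD => le_antisymm (hC.le_of_ge hD hCD) hCD⟩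

theorem aux_uniform {A : Type u} [Ring A] {E : Type u} [AddCommGroup E] [Module A E]
    (hinj : Module.Injective A E)
    (hindec : ∀ U V : Submodule A E, IsCompl U V → U = ⊥ ∨ V = ⊥)
    (U V : Submodule A E) (h : Disjoint U V) : U = ⊥ ∨ V = ⊥ := by
  obtain ⟨C, hVC, hCU, hC⟩ := aux_exists_max_disj U V h.symm
  obtain ⟨D, hUD, hDC, hD⟩ := aux_exists_max_disj C U hCU.symm
  -- the projection
  have hinj' : Function.Injective (LinearMap.coprod D.subtype C.subtype) := by
    rw [← LinearMap.ker_eq_bot, LinearMap.ker_coprod_of_disjoint_range]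
    · simp
    · simpa using hDC
  obtain ⟨g, hg⟩ := hinj.out (LinearMap.coprod D.subtype C.subtype) hinj'
    (D.subtype.comp (LinearMap.fst A D C))
  have hgD : ∀ d ∈ D, g d = d := fun d hd => by simpa using hg (⟨d, hd⟩, 0)
  have hgC : ∀ c ∈ C, g c = 0 := fun c hc => by simpa using hg (0, ⟨c, hc⟩)
  have hker : LinearMap.ker g = C := by
    apply hC
    · intro c hc; exact hgC c hc
    · rw [Submodule.disjoint_def]
      intro x hx hxU
      rw [← hgD x (hUD hxU)]; exact hx
  have hrange : LinearMap.range g = D := by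
    apply hD
    · intro d hd; exact ⟨d, hgD d hd⟩
    · rw [Submodule.disjoint_def]
      rintro _ ⟨x, rfl⟩ hxC
      by_contra hne
      -- C + A x strictly bigger than C, meets U
      have hx : x ∉ C := fun hx => hne (hgC x hx)
      have : ¬ Disjoint (C ⊔ Submodule.span A {x}) U := by
        intro hdis
        have := hC _ le_sup_left hdis
        apply hx
        rw [← this]
        exact Submodule.mem_sup_right (Submodule.mem_span_singleton_self x)
      rw [Submodule.disjoint_def] at this
      push Not at this
      obtain ⟨u, hu, huU, hu0⟩ := this
      obtain ⟨c, hc, y, hy, rfl⟩ := Submodule.mem_sup.1 hu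
      obtain ⟨a, rfl⟩ := Submodule.mem_span_singleton.1 hy
      apply hu0
      have h1 : g (c + a • x) = c + a • x := hgD _ (hUD huU)
      have h2 : g (c + a • x) = a • g x := by simp [hgC c hc]
      refine (Submodule.disjoint_def.1 hDC) _ (hUD huU) ?_
      rw [← h1, h2]
      exact C.smul_mem _ hxC
  have hcompl : IsCompl D C := by
    refine ⟨hDC, ?_⟩
    rw [codisjoint_iff, eq_top_iff]
    intro x _
    rw [Submodule.mem_sup]
    refine ⟨g x, hrange ▸ ⟨x, rfl⟩, x - g x, ?_, by simp⟩
    rw [← hker]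
    simp [hgD (g x) (hrange ▸ ⟨x, rfl⟩)]
  rcases hindec D C hcompl with h | h
  · left; rw [eq_bot_iff, ← h]; exact hUD
  · right; rw [eq_bot_iff, ← h]; exact hVC

theorem aux_ratFunc {k : Type u} [Field k] {V : Type u} [AddCommGroup V] [Module (Polynomial k) V]
    (v : V) (hv : v ≠ 0)
    (htf : ∀ (p : Polynomial k) (w : V), p ≠ 0 → p • w = 0 → w = 0)
    (hdiv : ∀ (p : Polynomial k) (w : V), p ≠ 0 → ∃ w', p • w' = w)
    (hun : ∀ w : V, ∃ p r : Polynomial k, p ≠ 0 ∧ p • w = r • v) :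
    Nonempty (V ≃ₗ[Polynomial k] RatFunc k) := by
  have : IsLocalizedModule (nonZeroDivisors (Polynomial k))
      (LinearMap.toSpanSingleton (Polynomial k) V v) := by
    refine ⟨?_, ?_, ?_⟩
    · rintro ⟨p, hp⟩
      have hp0 := nonZeroDivisors.ne_zero hp
      rw [Module.End.isUnit_iff]
      constructor
      · rw [injective_iff_map_eq_zero]
        intro w hw
        exact htf p w hp0 hw
      · intro w
        exact hdiv p w hp0
    · intro w
      obtain ⟨p, r, hp, h⟩ := hun w
      exact ⟨(r, ⟨p, mem_nonZeroDivisors_of_ne_zero hp⟩), h⟩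
    · intro p q h
      refine ⟨1, ?_⟩
      simp only [LinearMap.toSpanSingleton_apply] at h
      rw [← sub_eq_zero, ← sub_smul] at h
      by_contra hne
      simp only [one_smul] at hne
      exact hv (htf _ _ (sub_ne_zero.2 hne) h)
  exact ⟨IsLocalizedModule.linearEquiv (nonZeroDivisors (Polynomial k))
    (LinearMap.toSpanSingleton (Polynomial k) V v)
    (Algebra.linearMap (Polynomial k) (RatFunc k))⟩

section skew

variable {R S : Type u} [CommRing R] [Ring S] {α : R ≃+* R} {φ : R →+* S} {θ : S}

noncomputable def skSum (φ : R →+* S) (θ : S) : (ℕ →₀ R) →+ S :=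
  Finsupp.liftAddHom (fun n => (AddMonoidHom.mulRight (θ ^ n)).comp φ.toAddMonoidHom)

theorem skSum_apply (p : ℕ →₀ R) : skSum φ θ p = p.sum fun n r => φ r * θ ^ n := rfl

theorem skSum_single (n : ℕ) (r : R) : skSum φ θ (Finsupp.single n r) = φ r * θ ^ n := by
  rw [skSum_apply, Finsupp.sum_single_index]; simp

theorem skSum_bij (hS : IsSkewPolynomialRing α φ θ) : Function.Bijective (skSum φ θ) := hS.bijective

theorem theta_pow_comm (hS : IsSkewPolynomialRing α φ θ) (n : ℕ) (r : R) :
    θ ^ n * φ r = φ ((α ^ n) r) * θ ^ n := by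
  induction n generalizing r with
  | zero => simp
  | succ n ih =>
    rw [pow_succ, mul_assoc, hS.commutes, ← mul_assoc, ih, mul_assoc, pow_succ α]
    rfl

theorem skSum_mul_phi (hS : IsSkewPolynomialRing α φ θ) (r : R) (p : ℕ →₀ R) :
    ∃ p', skSum φ θ p' = skSum φ θ p * φ r ∧ ∀ n, p' n = p n * (α ^ n) r := by
  induction p using Finsupp.induction_linear with
  | zero => exact ⟨0, by simp, by simp⟩
  | add f g hf hg =>
    obtain ⟨f', h1, h2⟩ := hf
    obtain ⟨g', h3, h4⟩ := hg
    exact ⟨f' + g', by simp [h1, h3, add_mul], by simp [h2, h4, add_mul]⟩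
  | single n a =>
    refine ⟨Finsupp.single n (a * (α ^ n) r), ?_, ?_⟩
    · rw [skSum_single, skSum_single, mul_assoc, theta_pow_comm hS, map_mul, mul_assoc]
    · intro m
      by_cases h : n = m
      · subst h; simp
      · simp [Finsupp.single_apply, h]

theorem skSum_phi_mul (r : R) (p : ℕ →₀ R) :
    ∃ p', skSum φ θ p' = φ r * skSum φ θ p ∧ ∀ n, p' n = r * p n := by
  induction p using Finsupp.induction_linear with
  | zero => exact ⟨0, by simp, by simp⟩
  | add f g hf hg =>
    obtain ⟨f', h1, h2⟩ := hf
    obtain ⟨g', h3, h4⟩ := hg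
    exact ⟨f' + g', by simp [h1, h3, mul_add], by simp [h2, h4, mul_add]⟩
  | single n a =>
    refine ⟨Finsupp.single n (r * a), ?_, ?_⟩
    · rw [skSum_single, skSum_single, map_mul, mul_assoc]
    · intro m
      by_cases h : n = m
      · subst h; simp
      · simp [Finsupp.single_apply, h]

theorem skSum_mul_theta (p : ℕ →₀ R) :
    ∃ p', skSum φ θ p' = skSum φ θ p * θ ∧ p' 0 = 0 ∧ ∀ n, p' (n + 1) = p n := by
  induction p using Finsupp.induction_linear with
  | zero => exact ⟨0, by simp, by simp⟩
  | add f g hf hg =>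
    obtain ⟨f', h1, h2, h2'⟩ := hf
    obtain ⟨g', h3, h4, h4'⟩ := hg
    exact ⟨f' + g', by simp [h1, h3, add_mul], by simp [h2, h4], by simp [h2', h4']⟩
  | single n a =>
    refine ⟨Finsupp.single (n + 1) a, ?_, ?_, ?_⟩
    · rw [skSum_single, skSum_single, pow_succ, mul_assoc]
    · simp
    · intro m
      simp [Finsupp.single_apply]

/-- Induction principle. -/
theorem sk_induction (hS : IsSkewPolynomialRing α φ θ) {P : S → Prop}
    (hφ : ∀ r, P (φ r)) (hθ : P θ) (hadd : ∀ s t, P s → P t → P (s + t))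
    (hmul : ∀ s t, P s → P t → P (s * t)) (s : S) : P s := by
  obtain ⟨p, rfl⟩ := (skSum_bij hS).2 s
  induction p using Finsupp.induction_linear with
  | zero => simpa using hφ 0
  | add f g hf hg => rw [map_add]; exact hadd _ _ hf hg
  | single n a =>
    rw [skSum_single]
    refine hmul _ _ (hφ a) ?_
    induction n with
    | zero => simpa using hφ 1
    | succ n ih => rw [pow_succ]; exact hmul _ _ ih hθ

/-- leading coefficient ideals -/
def lead (hS : IsSkewPolynomialRing α φ θ) (I : Submodule Sᵐᵒᵖ S) (d : ℕ) : Ideal R where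
  carrier := {r | ∃ p : ℕ →₀ R, skSum φ θ p ∈ I ∧ (∀ m, d < m → p m = 0) ∧ p d = r}
  zero_mem' := ⟨0, by simp, by simp, by simp⟩
  add_mem' := by
    rintro _ _ ⟨p, h1, h2, rfl⟩ ⟨q, h3, h4, rfl⟩
    refine ⟨p + q, by rw [map_add]; exact I.add_mem h1 h3, fun m hm => ?_, by simp⟩
    simp [h2 m hm, h4 m hm]
  smul_mem' := by
    rintro c _ ⟨p, h1, h2, rfl⟩
    obtain ⟨p', h3, h4⟩ := skSum_mul_phi hS ((α ^ d).symm c) p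
    refine ⟨p', ?_, fun m hm => ?_, ?_⟩
    · rw [h3]; exact I.smul_mem (op (φ ((α ^ d).symm c))) h1
    · rw [h4, h2 m hm, zero_mul]
    · rw [h4, RingEquiv.apply_symm_apply, smul_eq_mul, mul_comm]

theorem lead_mono (hS : IsSkewPolynomialRing α φ θ) {I J : Submodule Sᵐᵒᵖ S} (h : I ≤ J) (d : ℕ) :
    lead hS I d ≤ lead hS J d := by
  rintro _ ⟨p, h1, h2, rfl⟩
  exact ⟨p, h h1, h2, rfl⟩

theorem lead_mono_succ (hS : IsSkewPolynomialRing α φ θ) (I : Submodule Sᵐᵒᵖ S) (d : ℕ) :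
    lead hS I d ≤ lead hS I (d + 1) := by
  rintro _ ⟨p, h1, h2, rfl⟩
  obtain ⟨p', h3, h4, h5⟩ := skSum_mul_theta (φ := φ) (θ := θ) p
  refine ⟨p', ?_, fun m hm => ?_, h5 d⟩
  · rw [h3]; exact I.smul_mem (op θ) h1
  · obtain ⟨m, rfl⟩ : ∃ m', m = m' + 1 := ⟨m - 1, by omega⟩
    rw [h5, h2 m (by omega)]

theorem eq_of_lead (hS : IsSkewPolynomialRing α φ θ) {I J : Submodule Sᵐᵒᵖ S} (h : I ≤ J)
    (hl : ∀ d, lead hS J d ≤ lead hS I d) : J ≤ I := by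
  have key : ∀ d, ∀ p : ℕ →₀ R, (∀ m, d ≤ m → p m = 0) → skSum φ θ p ∈ J → skSum φ θ p ∈ I := by
    intro d
    induction d with
    | zero =>
      intro p hp _
      have : p = 0 := by ext m; exact hp m (Nat.zero_le _)
      rw [this]; simp
    | succ d ih =>
      intro p hp hpJ
      obtain ⟨q, h1, h2, h3⟩ := hl d ⟨p, hpJ, fun m hm => hp m hm, rfl⟩
      have h4 : skSum φ θ (p - q) ∈ I := by
        apply ih
        · intro m hm
          rcases hm.eq_or_lt with rfl | hm
          · simp [h3]
          · simp [hp m hm, h2 m hm]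
        · rw [map_sub]; exact J.sub_mem hpJ (h h1)
      have h5 := I.add_mem h4 h1
      rwa [← map_add, sub_add_cancel] at h5
  intro s hs
  obtain ⟨p, rfl⟩ := (skSum_bij hS).2 s
  refine key (p.support.sup id + 1) p (fun m hm => ?_) hs
  by_contra hne
  have : m ≤ p.support.sup id := Finset.le_sup (f := id) (Finsupp.mem_support_iff.2 hne)
  omega

theorem sk_acc [IsNoetherianRing R] (hS : IsSkewPolynomialRing α φ θ)
    (I : ℕ → Submodule Sᵐᵒᵖ S) (hI : Monotone I) : ∃ n, I (n + 1) ≤ I n := by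
  have hd : ∀ J : Submodule Sᵐᵒᵖ S, Monotone (lead hS J) :=
    fun J => monotone_nat_of_le_succ (lead_mono_succ hS J)
  have hst : ∀ f : ℕ → Ideal R, Monotone f → ∃ N, ∀ n, N ≤ n → f N = f n := fun f hf =>
    monotone_stabilizes_iff_noetherian.2 (inferInstance : IsNoetherian R R) ⟨f, hf⟩
  obtain ⟨N, hN⟩ := hst (fun n => lead hS (I n) n) (fun a b hab =>
    (lead_mono hS (hI hab) a).trans (hd _ hab))
  choose M hM using fun d => hst (fun n => lead hS (I n) d) (fun a b hab => lead_mono hS (hI hab) d)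
  refine ⟨N + (Finset.range N).sup M, eq_of_lead hS (hI (Nat.le_succ _)) fun d => ?_⟩
  set n := N + (Finset.range N).sup M with hn
  rcases lt_or_ge d N with h | h
  · have h1 : M d ≤ (Finset.range N).sup M := Finset.le_sup (Finset.mem_range.2 h)
    have h2 := hM d n (by omega)
    have h3 := hM d (n + 1) (by omega)
    exact le_of_eq (h3.symm.trans h2)
  · calc lead hS (I (n + 1)) d ≤ lead hS (I (n + 1 + d)) (n + 1 + d) :=
          (lead_mono hS (hI (by omega)) _).trans (hd _ (by omega))
      _ = lead hS (I N) N := (hN _ (by omega)).symm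
      _ ≤ lead hS (I n) d := (lead_mono hS (hI (by omega)) _).trans (hd _ h)

end skew

section abstractpart

structure SFacts {k S : Type u} [Field k] [Ring S] (x : S) (η : Polynomial k →+* S) : Prop where
  nl : ∀ s, ∃ t, s * x = x * t
  nr : ∀ t, ∃ s, x * t = s * x
  rl : ∀ s, x * s = 0 → s = 0
  rr : ∀ s, s * x = 0 → s = 0
  dec : ∀ s, ∃ p t, s = η p + x * t
  uni : ∀ p t, η p = x * t → p = 0
  acc : ∀ I : ℕ → Submodule Sᵐᵒᵖ S, Monotone I → ∃ n, I (n + 1) ≤ I n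

variable {k S : Type u} [Field k] [Ring S] {x : S} {η : Polynomial k →+* S}

namespace SFacts

theorem nlp (F : SFacts x η) (n : ℕ) : ∀ s, ∃ t, s * x ^ n = x ^ n * t := by
  induction n with
  | zero => intro s; exact ⟨s, by simp⟩
  | succ n ih =>
    intro s
    obtain ⟨t, ht⟩ := ih s
    obtain ⟨t', ht'⟩ := F.nl t
    exact ⟨t', by rw [pow_succ, ← mul_assoc, ht, mul_assoc, ht', mul_assoc]⟩

theorem nrp (F : SFacts x η) (n : ℕ) : ∀ t, ∃ s, x ^ n * t = s * x ^ n := by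
  induction n with
  | zero => intro s; exact ⟨s, by simp⟩
  | succ n ih =>
    intro t
    obtain ⟨s, hs⟩ := F.nr t
    obtain ⟨s', hs'⟩ := ih s
    exact ⟨s', by rw [pow_succ, mul_assoc, hs, ← mul_assoc, hs', mul_assoc]⟩

theorem rlp (F : SFacts x η) (n : ℕ) (s : S) (h : x ^ n * s = 0) : s = 0 := by
  induction n with
  | zero => simpa using h
  | succ n ih => exact ih (F.rl _ (by rw [← mul_assoc, ← pow_succ']; exact h))

theorem rrp (F : SFacts x η) (n : ℕ) (s : S) (h : s * x ^ n = 0) : s = 0 := by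
  induction n with
  | zero => simpa using h
  | succ n ih => exact ih (F.rr _ (by rw [mul_assoc, ← pow_succ]; exact h))

theorem twist (F : SFacts x η) (n : ℕ) (p : Polynomial k) :
    ∃ p', (p ≠ 0 → p' ≠ 0) ∧ ∃ t, η p * x ^ n = x ^ n * η p' + x ^ (n + 1) * t := by
  obtain ⟨t0, h0⟩ := F.nlp n (η p)
  obtain ⟨p', t, h1⟩ := F.dec t0
  refine ⟨p', fun hp hp' => hp ?_, t, by rw [h0, h1, pow_succ]; noncomm_ring⟩
  subst hp'
  obtain ⟨t', ht'⟩ := F.nrp n t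
  apply F.uni p t'
  rw [← sub_eq_zero]
  apply F.rrp n
  rw [sub_mul, h0, h1, mul_assoc, ← ht', map_zero, zero_add, ← mul_assoc, ← mul_assoc,
    ← pow_succ, ← pow_succ', sub_self]

theorem twist' (F : SFacts x η) (n : ℕ) (p' : Polynomial k) :
    ∃ p, (p' ≠ 0 → p ≠ 0) ∧ ∃ t, η p * x ^ n = x ^ n * η p' + x ^ (n + 1) * t := by
  obtain ⟨s, h0⟩ := F.nrp n (η p')
  obtain ⟨p, t, h1⟩ := F.dec s
  obtain ⟨t', ht'⟩ := F.nlp n t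
  have key : η p * x ^ n = x ^ n * η p' + x ^ (n + 1) * (-t') := by
    rw [h0, h1, add_mul, mul_assoc x, ht', pow_succ']; noncomm_ring
  refine ⟨p, fun hp' hp => hp' ?_, -t', key⟩
  subst hp
  apply F.uni p' t'
  rw [← sub_eq_zero]
  apply F.rlp n
  rw [map_zero, zero_mul] at key
  rw [mul_sub, ← mul_assoc, ← pow_succ, key]
  noncomm_ring

variable {E : Type u} [AddCommGroup E] [Module Sᵐᵒᵖ E]

/-- the annihilator of `x^n` -/
def annC (F : SFacts x η) (E : Type u) [AddCommGroup E] [Module Sᵐᵒᵖ E] (n : ℕ) :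
    Submodule Sᵐᵒᵖ E where
  carrier := {e | op (x ^ n) • e = 0}
  zero_mem' := smul_zero _
  add_mem' := by
    intro a b ha hb
    simp only [Set.mem_ofPred_eq] at *
    rw [smul_add, ha, hb, add_zero]
  smul_mem' := by
    intro c e he
    simp only [Set.mem_ofPred_eq] at *
    obtain ⟨t, ht⟩ := F.nlp n c.unop
    have : op (x ^ n) * c = op t * op (x ^ n) := by
      rw [← op_mul, ← ht]; simp
    rw [smul_smul, this, mul_smul, he, smul_zero]

theorem mem_annC (F : SFacts x η) (n : ℕ) (e : E) : e ∈ F.annC E n ↔ op (x ^ n) • e = 0 := Iff.rfl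

theorem annC_le (F : SFacts x η) {m n : ℕ} (h : m ≤ n) : F.annC E m ≤ F.annC E n := by
  intro e he
  rw [mem_annC] at *
  obtain ⟨d, rfl⟩ := Nat.exists_eq_add_of_le h
  rw [pow_add, op_mul, mul_smul, he, smul_zero]

theorem mem_annC_add (F : SFacts x η) (m n : ℕ) (e : E) :
    op (x ^ n) • e ∈ F.annC E m ↔ e ∈ F.annC E (n + m) := by
  rw [mem_annC, mem_annC, smul_smul, ← op_mul, ← pow_add]

theorem twist_smul (F : SFacts x η) {n : ℕ} {e : E} (he : e ∈ F.annC E (n + 1))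
    {p p' : Polynomial k} (h : ∃ t, η p * x ^ n = x ^ n * η p' + x ^ (n + 1) * t) :
    op (x ^ n) • op (η p) • e = op (η p') • op (x ^ n) • e := by
  obtain ⟨t, ht⟩ := h
  rw [smul_smul, ← op_mul, ht, op_add, add_smul, op_mul, op_mul, mul_smul, mul_smul,
    (F.mem_annC _ _).1 he, smul_zero, add_zero]

end SFacts

/-- orbit map -/
def orb {E : Type u} [AddCommGroup E] [Module Sᵐᵒᵖ E] (e : E) : S →ₗ[Sᵐᵒᵖ] E where
  toFun s := op s • e
  map_add' a b := by rw [op_add, add_smul]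
  map_smul' c s := by
    rw [RingHom.id_apply, smul_smul]; rfl

theorem orb_apply {E : Type u} [AddCommGroup E] [Module Sᵐᵒᵖ E] (e : E) (s : S) :
    orb e s = op s • e := rfl

/-- left multiplication -/
def lmulR (c : S) : S →ₗ[Sᵐᵒᵖ] S where
  toFun s := c * s
  map_add' a b := mul_add _ _ _
  map_smul' a s := by simp [mul_assoc]

theorem mem_rSpan (z s : S) : s ∈ rSpan S z ↔ ∃ t, s = z * t := by
  rw [Submodule.mem_span_singleton]
  constructor
  · rintro ⟨a, rfl⟩; exact ⟨a.unop, rfl⟩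
  · rintro ⟨t, rfl⟩; exact ⟨op t, rfl⟩

namespace SFacts

variable {E : Type u} [AddCommGroup E] [Module Sᵐᵒᵖ E]

theorem x_div (F : SFacts x η) (hinj : Module.Injective Sᵐᵒᵖ E) (n : ℕ) (e : E) :
    ∃ m : E, op (x ^ n) • m = e := by
  obtain ⟨h, hh⟩ := hinj.out (lmulR (x ^ n)) (by
    rw [injective_iff_map_eq_zero]
    intro s hs
    exact F.rlp n s hs) (orb e)
  refine ⟨h 1, ?_⟩
  have := hh 1
  rw [orb_apply, op_one, one_smul] at this
  rw [← map_smul, ← this]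
  congr 1
  change 1 * x ^ n = x ^ n * 1
  simp

theorem mem_ann_one (F : SFacts x η) (a : E) : a ∈ F.annC E 1 ↔ op x • a = 0 := by
  rw [mem_annC, pow_one]

theorem smul_ann_one (F : SFacts x η) {a : E} (ha : a ∈ F.annC E 1) (s : S) :
    op (x * s) • a = 0 := by
  rw [op_mul, mul_smul, (F.mem_ann_one a).1 ha, smul_zero]

theorem smul_dec (F : SFacts x η) {a : E} (ha : a ∈ F.annC E 1) (s : S) :
    ∃ p : Polynomial k, (∃ t, s = η p + x * t) ∧ op s • a = op (η p) • a := by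
  obtain ⟨p, t, rfl⟩ := F.dec s
  exact ⟨p, ⟨t, rfl⟩, by rw [op_add, add_smul, F.smul_ann_one ha, add_zero]⟩

theorem smul_mul_comm (p q : Polynomial k) (a : E) :
    op (η (p * q)) • a = op (η p) • op (η q) • a := by
  rw [smul_smul, ← op_mul, ← map_mul, mul_comm]

/-- divisibility of `Ann_E(x)` by nonzero polynomials -/
theorem p_div (F : SFacts x η) (hinj : Module.Injective Sᵐᵒᵖ E) {p : Polynomial k} (hp : p ≠ 0)
    {a : E} (ha : a ∈ F.annC E 1) : ∃ b ∈ F.annC E 1, op (η p) • b = a := by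
  have hle : rSpan S x ≤ (rSpan S x).comap (lmulR (η p)) := by
    intro s hs
    obtain ⟨t, rfl⟩ := (mem_rSpan _ _).1 hs
    obtain ⟨t', ht'⟩ := F.nl (η p)
    refine (mem_rSpan _ _).2 ⟨t' * t, ?_⟩
    change η p * (x * t) = _
    rw [← mul_assoc, ht', mul_assoc]
  have hle2 : rSpan S x ≤ LinearMap.ker (orb a) := by
    intro s hs
    obtain ⟨t, rfl⟩ := (mem_rSpan _ _).1 hs
    exact F.smul_ann_one ha t
  obtain ⟨h, hh⟩ := hinj.out (Submodule.mapQ _ _ (lmulR (η p)) hle) (by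
    rw [← LinearMap.ker_eq_bot, LinearMap.ker_eq_bot']
    intro m hm
    obtain ⟨s, rfl⟩ := Submodule.Quotient.mk_surjective _ m
    rw [Submodule.mapQ_apply, Submodule.Quotient.mk_eq_zero, mem_rSpan] at hm
    rw [Submodule.Quotient.mk_eq_zero, mem_rSpan]
    obtain ⟨t, ht⟩ := hm
    change η p * s = _ at ht
    obtain ⟨r, t', rfl⟩ := F.dec s
    obtain ⟨t'', ht''⟩ := F.nl (η p)
    have : p * r = 0 := F.uni (p * r) (t - t'' * t') (by
      rw [map_mul, mul_sub, ← ht, ← mul_assoc x, ← ht'']; noncomm_ring)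
    rcases mul_eq_zero.1 this with h | h
    · exact absurd h hp
    · exact ⟨t', by simp [h]⟩) ((rSpan S x).liftQ (orb a) hle2)
  refine ⟨h (Submodule.Quotient.mk 1), ?_, ?_⟩
  · rw [F.mem_ann_one, ← map_smul, ← Submodule.Quotient.mk_smul]
    have : (Submodule.Quotient.mk (op x • (1 : S)) : S ⧸ rSpan S x) = 0 := by
      rw [Submodule.Quotient.mk_eq_zero, mem_rSpan]
      exact ⟨1, by simp⟩
    rw [this, map_zero]
  · have := hh (Submodule.Quotient.mk 1)
    rw [Submodule.mapQ_apply, Submodule.liftQ_apply, orb_apply, op_one, one_smul] at this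
    rw [← this, ← map_smul, ← Submodule.Quotient.mk_smul]
    congr 2
    change 1 * η p = η p * 1
    simp

/-- uniformity, elementwise -/
def Unif (S E : Type u) [Ring S] [AddCommGroup E] [Module Sᵐᵒᵖ E] : Prop :=
  ∀ e f : E, e ≠ 0 → f ≠ 0 → ∃ s t : S, op s • e = op t • f ∧ op s • e ≠ 0

theorem unif_ann (F : SFacts x η) (hU : Unif S E) {a b : E} (ha : a ∈ F.annC E 1)
    (hb : b ∈ F.annC E 1) (ha0 : a ≠ 0) (hb0 : b ≠ 0) :
    ∃ p q : Polynomial k, op (η p) • a = op (η q) • b ∧ op (η p) • a ≠ 0 := by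
  obtain ⟨s, t, h1, h2⟩ := hU a b ha0 hb0
  obtain ⟨p, -, hp⟩ := F.smul_dec ha s
  obtain ⟨q, -, hq⟩ := F.smul_dec hb t
  exact ⟨p, q, by rw [← hp, ← hq, h1], by rwa [← hp]⟩

theorem torsion (F : SFacts x η) (hU : Unif S E)
    (htor : ∃ e : E, e ≠ 0 ∧ ∃ n : ℕ, op (x ^ n) • e = 0) :
    (∃ a ∈ F.annC E 1, a ≠ 0) ∧ IsXTorsion x E := by
  have hA : ∃ a ∈ F.annC E 1, a ≠ 0 := by
    obtain ⟨e, he, n, hn⟩ := htor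
    induction n generalizing e with
    | zero => simp at hn; exact absurd hn he
    | succ n ih =>
      by_cases h : op x • e = 0
      · exact ⟨e, (F.mem_ann_one e).2 h, he⟩
      · exact ih (op x • e) h (by rw [smul_smul, ← op_mul, ← pow_succ', hn])
  refine ⟨hA, fun e => ?_⟩
  obtain ⟨a, ha, ha0⟩ := hA
  obtain ⟨n, hn⟩ := F.acc (fun n => (F.annC E n).comap (orb e))
    (fun i j hij => Submodule.comap_mono (F.annC_le hij))
  refine ⟨n, ?_⟩
  by_contra hne
  obtain ⟨s, t, h1, h2⟩ := hU (op (x ^ n) • e) a hne ha0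
  obtain ⟨s', hs'⟩ := F.nrp n s
  have h3 : op s • op (x ^ n) • e = op (x ^ n) • op s' • e := by
    rw [smul_smul, smul_smul, ← op_mul, ← op_mul, hs']
  apply h2
  rw [h3]
  have : s' ∈ (F.annC E (n + 1)).comap (orb e) := by
    rw [Submodule.mem_comap, orb_apply, ← F.mem_annC_add, ← h3, h1]
    exact Submodule.smul_mem _ _ ha
  exact hn this

theorem ess_of_unif (hU : Unif S E) (U : Submodule Sᵐᵒᵖ E) (hne : U ≠ ⊥) :
    IsEssentialSubmodule U := by
  intro W hW h
  obtain ⟨w, hw, hw0⟩ := Submodule.exists_mem_ne_zero_of_ne_bot hW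
  obtain ⟨u, hu, hu0⟩ := Submodule.exists_mem_ne_zero_of_ne_bot hne
  obtain ⟨s, t, h1, h2⟩ := hU w u hw0 hu0
  apply h2
  rw [← Submodule.mem_bot Sᵐᵒᵖ, ← h]
  exact ⟨W.smul_mem _ hw, h1 ▸ U.smul_mem _ hu⟩

/-- hulls from orbit maps -/
theorem hull_of_orb (hinj : Module.Injective Sᵐᵒᵖ E) (hU : Unif S E) (a : E) (ha : a ≠ 0)
    (K : Submodule Sᵐᵒᵖ S) (hK : ∀ s, s ∈ K ↔ op s • a = 0) :
    ∃ f : (S ⧸ K) →ₗ[Sᵐᵒᵖ] E, IsInjectiveHullVia Sᵐᵒᵖ f := by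
  have hle : K ≤ LinearMap.ker (orb a) := fun s hs => LinearMap.mem_ker.2 ((hK s).1 hs)
  refine ⟨K.liftQ (orb a) hle, hinj, ?_, ?_⟩
  · rw [← LinearMap.ker_eq_bot, LinearMap.ker_eq_bot']
    intro m hm
    obtain ⟨s, rfl⟩ := Submodule.Quotient.mk_surjective _ m
    rw [Submodule.liftQ_apply] at hm
    rw [Submodule.Quotient.mk_eq_zero, hK]
    exact hm
  · apply ess_of_unif hU
    intro h
    apply ha
    rw [← Submodule.mem_bot Sᵐᵒᵖ, ← h]
    exact ⟨Submodule.Quotient.mk 1, by rw [Submodule.liftQ_apply, orb_apply, op_one, one_smul]⟩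

theorem irr (F : SFacts x η) {p : Polynomial k} (hp : p ≠ 0) {a : E} (ha : a ∈ F.annC E 1)
    (ha0 : a ≠ 0) (h : op (η p) • a = 0) :
    ∃ q : Polynomial k, Irreducible q ∧ ∃ b ∈ F.annC E 1, b ≠ 0 ∧ op (η q) • b = 0 := by
  induction p using WfDvdMonoid.induction_on_irreducible generalizing a with
  | zero => exact absurd rfl hp
  | unit u hu =>
    obtain ⟨v, hv⟩ := hu.exists_left_inv
    exfalso; apply ha0
    have := smul_mul_comm (η := η) v u a
    rw [hv, h, smul_zero, map_one, op_one, one_smul] at this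
    exact this
  | mul p i hp0 hi ih =>
    by_cases h0 : op (η p) • a = 0
    · exact ih hp0 ha ha0 h0
    · refine ⟨i, hi, _, Submodule.smul_mem _ _ ha, h0, ?_⟩
      rw [← smul_mul_comm, h]

theorem hull2 (F : SFacts x η) (hinj : Module.Injective Sᵐᵒᵖ E) (hU : Unif S E)
    {p : Polynomial k} (hp : Irreducible p) {a : E} (ha : a ∈ F.annC E 1)
    (ha0 : a ≠ 0) (h : op (η p) • a = 0) :
    ∃ f : rQuot2 S x (η p) →ₗ[Sᵐᵒᵖ] E, IsInjectiveHullVia Sᵐᵒᵖ f := by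
  apply hull_of_orb hinj hU a ha0
  intro s
  constructor
  · intro hs
    obtain ⟨y, hy, z, hz, rfl⟩ := Submodule.mem_sup.1 hs
    obtain ⟨y, rfl⟩ := (mem_rSpan _ _).1 hy
    obtain ⟨z, rfl⟩ := (mem_rSpan _ _).1 hz
    rw [op_add, add_smul, F.smul_ann_one ha, op_mul, mul_smul, h, smul_zero, add_zero]
  · intro hs
    obtain ⟨r, ⟨t, rfl⟩, hr⟩ := F.smul_dec ha s
    rw [hs] at hr
    have : p ∣ r := by
      by_contra hdvd
      obtain ⟨u, v, huv⟩ := (hp.coprime_iff_not_dvd).2 hdvd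
      apply ha0
      have h1 : op (η (u * p + v * r)) • a = 0 := by
        rw [map_add, op_add, add_smul, smul_mul_comm, smul_mul_comm, h, ← hr]; simp
      rwa [huv, map_one, op_one, one_smul] at h1
    obtain ⟨r', rfl⟩ := this
    rw [add_comm]
    exact Submodule.add_mem_sup ((mem_rSpan _ _).2 ⟨t, rfl⟩) ((mem_rSpan _ _).2 ⟨η r', map_mul _ _ _⟩)

theorem hull1 (F : SFacts x η) (hinj : Module.Injective Sᵐᵒᵖ E) (hU : Unif S E)
    {a : E} (ha : a ∈ F.annC E 1) (ha0 : a ≠ 0)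
    (htf : ∀ p : Polynomial k, op (η p) • a = 0 → p = 0) :
    ∃ f : rQuot S x →ₗ[Sᵐᵒᵖ] E, IsInjectiveHullVia Sᵐᵒᵖ f := by
  apply hull_of_orb hinj hU a ha0
  intro s
  constructor
  · intro hs
    obtain ⟨y, rfl⟩ := (mem_rSpan _ _).1 hs
    exact F.smul_ann_one ha _
  · intro hs
    obtain ⟨r, ⟨t, rfl⟩, hr⟩ := F.smul_dec ha s
    rw [hs] at hr
    rw [htf r hr.symm]
    exact (mem_rSpan _ _).2 ⟨t, by simp⟩

/-- `k[θ] → Sᵐᵒᵖ` -/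
noncomputable def etaOp (η : Polynomial k →+* S) : Polynomial k →+* Sᵐᵒᵖ :=
  η.toOpposite (fun p q => by rw [Commute, SemiconjBy, ← map_mul, ← map_mul, mul_comm])

theorem factor (F : SFacts x η) (hinj : Module.Injective Sᵐᵒᵖ E) (hU : Unif S E)
    {a : E} (ha : a ∈ F.annC E 1) (ha0 : a ≠ 0)
    (htf : ∀ p : Polynomial k, ∀ b ∈ F.annC E 1, p ≠ 0 → op (η p) • b = 0 → b = 0) (n : ℕ) :
    ∃ e : (↥(F.annC E (n + 1)) ⧸ Submodule.comap (F.annC E (n + 1)).subtype (F.annC E n)) ≃+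
        RatFunc k,
      ∀ (p : Polynomial k) m, e (op (η p) • m) = algebraMap (Polynomial k) (RatFunc k) p * e m := by
  set Q := (↥(F.annC E (n + 1)) ⧸ Submodule.comap (F.annC E (n + 1)).subtype (F.annC E n))
  let _ : Module (Polynomial k) Q := Module.compHom Q (etaOp η)
  have hsm : ∀ (p : Polynomial k) (m : Q), p • m = op (η p) • m := fun _ _ => rfl
  have hmk : ∀ m m' : F.annC E (n + 1),
      (Submodule.Quotient.mk m : Q) = Submodule.Quotient.mk m' ↔
        op (x ^ n) • (m : E) = op (x ^ n) • (m' : E) := by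
    intro m m'
    rw [Submodule.Quotient.eq, Submodule.mem_comap, F.mem_annC]
    simp [smul_sub, sub_eq_zero]
  have hmk0 : ∀ m : F.annC E (n + 1),
      (Submodule.Quotient.mk m : Q) = 0 ↔ op (x ^ n) • (m : E) = 0 := by
    intro m
    rw [← Submodule.Quotient.mk_zero, hmk]; simp
  have hin : ∀ m : F.annC E (n + 1), op (x ^ n) • (m : E) ∈ F.annC E 1 :=
    fun m => (F.mem_annC_add 1 n _).2 m.2
  obtain ⟨v, hv⟩ := F.x_div hinj n a
  have hv1 : v ∈ F.annC E (n + 1) := (F.mem_annC_add 1 n v).1 (hv ▸ ha)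
  obtain ⟨e⟩ := aux_ratFunc (k := k) (V := Q) (Submodule.Quotient.mk ⟨v, hv1⟩)
    (by rw [Ne, hmk0, hv]; exact ha0) (by
      intro p w hp hw
      obtain ⟨m, rfl⟩ := Submodule.Quotient.mk_surjective _ w
      rw [hsm, ← Submodule.Quotient.mk_smul, hmk0] at hw
      rw [hmk0]
      obtain ⟨p', hp', ht⟩ := F.twist n p
      rw [Submodule.coe_smul, F.twist_smul m.2 ht] at hw
      exact htf p' _ (hin m) (hp' hp) hw) (by
      intro p w hp
      obtain ⟨m, rfl⟩ := Submodule.Quotient.mk_surjective _ w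
      obtain ⟨p', hp', ht⟩ := F.twist n p
      obtain ⟨b, hb, hb2⟩ := F.p_div hinj (hp' hp) (hin m)
      obtain ⟨w', hw'⟩ := F.x_div hinj n b
      have hw1 : w' ∈ F.annC E (n + 1) := (F.mem_annC_add 1 n w').1 (hw' ▸ hb)
      refine ⟨Submodule.Quotient.mk ⟨w', hw1⟩, ?_⟩
      rw [hsm, ← Submodule.Quotient.mk_smul, hmk, Submodule.coe_smul]
      change op (x ^ n) • op (η p) • w' = _
      rw [F.twist_smul hw1 ht, hw', hb2]) (by
      intro w
      obtain ⟨m, rfl⟩ := Submodule.Quotient.mk_surjective _ w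
      by_cases h0 : op (x ^ n) • (m : E) = 0
      · refine ⟨1, 0, one_ne_zero, ?_⟩
        rw [zero_smul, one_smul, hmk0, h0]
      · obtain ⟨p', q', h1, h2⟩ := F.unif_ann hU (hin m) ha h0 ha0
        obtain ⟨p, hp, hpt⟩ := F.twist' n p'
        obtain ⟨q, hq, hqt⟩ := F.twist' n q'
        refine ⟨p, q, hp ?_, ?_⟩
        · rintro rfl; apply h2; simp
        · rw [hsm, hsm, ← Submodule.Quotient.mk_smul, ← Submodule.Quotient.mk_smul, hmk,
            Submodule.coe_smul, Submodule.coe_smul, F.twist_smul m.2 hpt]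
          change _ = op (x ^ n) • op (η q) • v
          rw [F.twist_smul hv1 hqt, hv, h1])
  refine ⟨e.toAddEquiv, fun p m => ?_⟩
  change e (p • m) = _
  rw [map_smul, Algebra.smul_def]
  rfl

/-- finite dimensionality of cyclic modules in case (2) -/
theorem fd [Module k E] (F : SFacts x η)
    (hk : ∀ (c : k) (e : E), c • e = op (η (Polynomial.C c)) • e) (hU : Unif S E)
    {a : E} (ha : a ∈ F.annC E 1) (ha0 : a ≠ 0) {p : Polynomial k} (hp : p ≠ 0)
    (h : op (η p) • a = 0) (n : ℕ) :
    ∀ e ∈ F.annC E n, ∃ W : Submodule k E, W.FG ∧ ∀ s : S, op s • e ∈ W := by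
  have htor : ∀ b ∈ F.annC E 1, ∃ f : Polynomial k, f ≠ 0 ∧ op (η f) • b = 0 := by
    intro b hb
    by_cases hb0 : b = 0
    · exact ⟨1, one_ne_zero, by simp [hb0]⟩
    · obtain ⟨u, v, h1, h2⟩ := F.unif_ann hU hb ha hb0 ha0
      refine ⟨p * u, mul_ne_zero hp ?_, ?_⟩
      · rintro rfl; simp at h2
      · rw [smul_mul_comm, h1, ← smul_mul_comm, mul_comm, smul_mul_comm, h, smul_zero]
  induction n with
  | zero =>
    intro e he
    have : e = 0 := by simpa [F.mem_annC] using he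
    exact ⟨⊥, Submodule.fg_bot, by simp [this]⟩
  | succ n ih =>
    intro e he
    obtain ⟨f, hf0, hf⟩ := htor _ ((F.mem_annC_add 1 n e).2 he)
    obtain ⟨g, hg0, hg⟩ := F.twist' n f
    replace hg0 := hg0 hf0
    have hge : op (η g) • e ∈ F.annC E n := by
      rw [F.mem_annC, F.twist_smul he hg, hf]
    have hxe : op x • e ∈ F.annC E n := by
      have := (F.mem_annC_add n 1 e).2 (by rw [add_comm]; exact he)
      simpa only [pow_one] using this
    obtain ⟨W1, hW1, hW1'⟩ := ih _ hge
    obtain ⟨W2, hW2, hW2'⟩ := ih _ hxe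
    let W0 : Submodule k E := Submodule.span k
      ((fun i => op (η (Polynomial.X ^ i)) • e) '' (Finset.range g.natDegree : Set ℕ))
    refine ⟨W0 ⊔ W1 ⊔ W2, ((Submodule.fg_span ((Finset.finite_toSet _).image _)).sup hW1).sup hW2, ?_⟩
    intro s
    obtain ⟨r, t, rfl⟩ := F.dec s
    rw [op_add, add_smul]
    refine Submodule.add_mem_sup ?_ ?_
    · have hr : r = r % g + g * (r / g) := (EuclideanDomain.mod_add_div r g).symm
      rw [hr, map_add, op_add, add_smul]
      refine Submodule.add_mem_sup ?_ ?_
      · by_cases hd : g.natDegree = 0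
        · have : IsUnit g := by
            rw [Polynomial.isUnit_iff_degree_eq_zero, Polynomial.degree_eq_natDegree hg0, hd]; rfl
          rw [EuclideanDomain.mod_eq_zero.2 this.dvd]; simp
        · have hlt : (r % g).natDegree < g.natDegree := Polynomial.natDegree_mod_lt r hd
          rw [Polynomial.as_sum_range' (r % g) g.natDegree hlt]
          have key : ∀ T : Finset ℕ, op (η (∑ i ∈ T, Polynomial.monomial i ((r % g).coeff i))) • e
              = ∑ i ∈ T, (r % g).coeff i • op (η (Polynomial.X ^ i)) • e := by
            intro T
            rw [map_sum, Finset.op_sum, Finset.sum_smul]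
            refine Finset.sum_congr rfl fun i _ => ?_
            rw [← Polynomial.C_mul_X_pow_eq_monomial, smul_mul_comm, hk]
          rw [key]
          refine Submodule.sum_mem _ fun i hi => Submodule.smul_mem _ _ (Submodule.subset_span ?_)
          exact ⟨i, by simpa using hi, rfl⟩
      · rw [mul_comm, smul_mul_comm]
        exact hW1' _
    · rw [op_mul, mul_smul]
      exact hW2' _

end SFacts
end abstractpart

section concrete

variable {k : Type u} [Field k] {R : Type u} [CommRing R] [Algebra k R]
  {S : Type u} [Ring S] {φ : R →+* S} {θ : S} {α : R ≃ₐ[k] R}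

/-- the embedding `k[θ] → S` -/
noncomputable def skEta (hS : IsSkewPolynomialRing α.toRingEquiv φ θ) : Polynomial k →+* S :=
  Polynomial.eval₂RingHom' (φ.comp (algebraMap k R)) θ (fun c => by
    have := hS.commutes (algebraMap k R c)
    rw [Commute, SemiconjBy, RingHom.comp_apply, this]
    congr 2
    exact (α.commutes c).symm)

theorem skEta_apply (hS : IsSkewPolynomialRing α.toRingEquiv φ θ) (p : Polynomial k) :
    skEta hS p = thetaPoly φ θ p := by
  change Polynomial.eval₂ _ _ _ = _
  rw [Polynomial.eval₂_eq_sum]; rfl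

theorem skEta_C (hS : IsSkewPolynomialRing α.toRingEquiv φ θ) (c : k) :
    skEta hS (Polynomial.C c) = φ (algebraMap k R c) := by
  change Polynomial.eval₂ _ _ _ = _
  simp

theorem skEta_X (hS : IsSkewPolynomialRing α.toRingEquiv φ θ) :
    skEta hS Polynomial.X = θ := by
  change Polynomial.eval₂ _ _ _ = _
  simp

theorem skEta_coeff (hS : IsSkewPolynomialRing α.toRingEquiv φ θ) (p : Polynomial k) :
    ∃ p', skSum φ θ p' = skEta hS p ∧ ∀ n, p' n = algebraMap k R (p.coeff n) := by
  induction p using Polynomial.induction_on' with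
  | add f g hf hg =>
    obtain ⟨f', h1, h2⟩ := hf
    obtain ⟨g', h3, h4⟩ := hg
    exact ⟨f' + g', by simp [h1, h3], by simp [h2, h4]⟩
  | monomial n a =>
    refine ⟨Finsupp.single n (algebraMap k R a), ?_, ?_⟩
    · rw [skSum_single, ← Polynomial.C_mul_X_pow_eq_monomial, map_mul, map_pow, skEta_C, skEta_X]
    · intro m
      rw [Polynomial.coeff_monomial, Finsupp.single_apply]
      split_ifs <;> simp

theorem skFacts [IsDomain R] [IsDiscreteValuationRing R]
    (X : R) (hX : IsLocalRing.maximalIdeal R = Ideal.span {X})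
    (hres : Function.Bijective ((IsLocalRing.residue R).comp (algebraMap k R)))
    (hS : IsSkewPolynomialRing α.toRingEquiv φ θ) : SFacts (φ X) (skEta hS) := by
  have hX0 : X ≠ 0 := by
    rintro rfl
    apply IsDiscreteValuationRing.not_a_field R
    rw [hX]; simp
  have hXm : X ∈ IsLocalRing.maximalIdeal R := hX ▸ Ideal.mem_span_singleton_self X
  have hdvd : ∀ r, r ∈ IsLocalRing.maximalIdeal R → ∃ q, r = X * q := by
    intro r hr
    rw [hX, Ideal.mem_span_singleton] at hr
    exact hr
  have haut : ∀ β : R ≃+* R, ∃ q, β X = X * q := by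
    intro β
    apply hdvd
    rw [IsLocalRing.mem_maximalIdeal, mem_nonunits_iff] at *
    rwa [MulEquiv.isUnit_map]
  have hcomm : ∀ r : R, φ r * φ X = φ X * φ r := fun r => by
    rw [← map_mul, ← map_mul, mul_comm]
  have nl : ∀ s, ∃ t, s * φ X = φ X * t := by
    intro s
    induction s using sk_induction hS with
    | hφ r => exact ⟨φ r, hcomm r⟩
    | hθ =>
      obtain ⟨q, hq⟩ := haut α.toRingEquiv
      exact ⟨φ q * θ, by rw [hS.commutes, hq, map_mul, mul_assoc]⟩
    | hadd s t hs ht =>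
      obtain ⟨s', hs⟩ := hs
      obtain ⟨t', ht⟩ := ht
      exact ⟨s' + t', by rw [add_mul, mul_add, hs, ht]⟩
    | hmul s t hs ht =>
      obtain ⟨s', hs⟩ := hs
      obtain ⟨t', ht⟩ := ht
      exact ⟨s' * t', by rw [mul_assoc, ht, ← mul_assoc, hs, mul_assoc]⟩
  have nr : ∀ s, ∃ t, φ X * s = t * φ X := by
    intro s
    induction s using sk_induction hS with
    | hφ r => exact ⟨φ r, (hcomm r).symm⟩
    | hθ =>
      obtain ⟨q, hq⟩ := haut α.toRingEquiv.symm
      refine ⟨θ * φ q, ?_⟩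
      rw [mul_assoc, hcomm, ← map_mul, ← hq, hS.commutes, RingEquiv.apply_symm_apply]
    | hadd s t hs ht =>
      obtain ⟨s', hs⟩ := hs
      obtain ⟨t', ht⟩ := ht
      exact ⟨s' + t', by rw [add_mul, mul_add, hs, ht]⟩
    | hmul s t hs ht =>
      obtain ⟨s', hs⟩ := hs
      obtain ⟨t', ht⟩ := ht
      exact ⟨s' * t', by rw [← mul_assoc, hs, mul_assoc, ht, mul_assoc]⟩
  refine ⟨nl, nr, ?_, ?_, ?_, ?_, fun I hI => sk_acc hS I hI⟩
  · intro s hs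
    obtain ⟨p, rfl⟩ := (skSum_bij hS).2 s
    obtain ⟨p', h1, h2⟩ := skSum_phi_mul (φ := φ) (θ := θ) X p
    rw [← h1] at hs
    have h3 : p' = 0 := (skSum_bij hS).1 (by rw [hs, map_zero])
    have : p = 0 := by
      ext n
      have := h2 n
      rw [h3, Finsupp.zero_apply, eq_comm, mul_eq_zero] at this
      exact this.resolve_left hX0
    rw [this, map_zero]
  · intro s hs
    obtain ⟨p, rfl⟩ := (skSum_bij hS).2 s
    obtain ⟨p', h1, h2⟩ := skSum_mul_phi hS X p
    rw [← h1] at hs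
    have h3 : p' = 0 := (skSum_bij hS).1 (by rw [hs, map_zero])
    have : p = 0 := by
      ext n
      have := h2 n
      rw [h3, Finsupp.zero_apply, eq_comm, mul_eq_zero] at this
      refine this.resolve_right ?_
      exact fun h0 => hX0 ((map_eq_zero_iff (α.toRingEquiv ^ n) (RingEquiv.injective _)).1 h0)
    rw [this, map_zero]
  · intro s
    induction s using sk_induction hS with
    | hφ r =>
      obtain ⟨c, hc⟩ := hres.2 (IsLocalRing.residue R r)
      obtain ⟨q, hq⟩ := hdvd (r - algebraMap k R c) (by
        rw [← IsLocalRing.residue_eq_zero_iff, map_sub, ← hc, RingHom.comp_apply, sub_self])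
      refine ⟨Polynomial.C c, φ q, ?_⟩
      rw [skEta_C, ← map_mul, ← hq, ← map_add]; simp
    | hθ => exact ⟨Polynomial.X, 0, by rw [skEta_X]; simp⟩
    | hadd s t hs ht =>
      obtain ⟨p, s', rfl⟩ := hs
      obtain ⟨q, t', rfl⟩ := ht
      exact ⟨p + q, s' + t', by rw [map_add]; noncomm_ring⟩
    | hmul s t hs ht =>
      obtain ⟨p, s', rfl⟩ := hs
      obtain ⟨q, t', rfl⟩ := ht
      obtain ⟨u, hu⟩ := nl (skEta hS p)
      refine ⟨p * q, u * t' + s' * (skEta hS q + φ X * t'), ?_⟩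
      rw [map_mul, mul_add (φ X), ← mul_assoc (φ X) u, ← hu]; noncomm_ring
  · intro p t hpt
    obtain ⟨q, rfl⟩ := (skSum_bij hS).2 t
    obtain ⟨q', h1, h2⟩ := skSum_phi_mul (φ := φ) (θ := θ) X q
    obtain ⟨p', h3, h4⟩ := skEta_coeff hS p
    have h5 : p' = q' := (skSum_bij hS).1 (by rw [h1, h3, hpt])
    ext n
    rw [Polynomial.coeff_zero]
    apply hres.1
    rw [map_zero, RingHom.comp_apply, ← h4, h5, h2, IsLocalRing.residue_eq_zero_iff]
    exact Ideal.mul_mem_right _ _ hXm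

theorem finDim_of_span {E : Type u} [AddCommGroup E] [Module Sᵐᵒᵖ E] [Module k E]
    (hk : ∀ (c : k) (e : E), c • e = op (φ (algebraMap k R c)) • e)
    (h : ∀ e : E, ∃ W : Submodule k E, W.FG ∧ ∀ s : S, op s • e ∈ W)
    (N : Submodule Sᵐᵒᵖ E) (hN : N.FG) : FinDimOver k φ N := by
  have key : ∃ W : Submodule k E, W.FG ∧ ∀ m ∈ N, m ∈ W := by
    induction N, hN using Submodule.fg_induction with
    | singleton e =>
      obtain ⟨W, hW, hs⟩ := h e
      refine ⟨W, hW, fun m hm => ?_⟩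
      obtain ⟨s, rfl⟩ := Submodule.mem_span_singleton.1 hm
      exact hs s.unop
    | sup M₁ M₂ _ _ h1 h2 =>
      obtain ⟨W1, hW1, hs1⟩ := h1
      obtain ⟨W2, hW2, hs2⟩ := h2
      refine ⟨W1 ⊔ W2, hW1.sup hW2, fun m hm => ?_⟩
      obtain ⟨y, hy, z, hz, rfl⟩ := Submodule.mem_sup.1 hm
      exact Submodule.add_mem_sup (hs1 y hy) (hs2 z hz)
  obtain ⟨W, hW, hm⟩ := key
  unfold FinDimOver
  let _ : Module k N := Module.compHom N (opScalars φ)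
  have : Module.Finite k W := Module.Finite.iff_fg.2 hW
  let f : N →ₗ[k] W :=
    { toFun := fun m => ⟨m.1, hm m.1 m.2⟩
      map_add' := fun _ _ => rfl
      map_smul' := fun c m => by
        apply Subtype.ext
        exact (hk c m.1).symm }
  refine Module.Finite.of_injective f ?_
  intro a b hab
  apply Subtype.ext
  exact congrArg (fun w : W => (w : E)) hab

end concrete

/-- Let `E` be an indecomposable injective right `S`-module whose
`𝒳`-torsion submodule is nonzero.  Then `E` is `𝒳`-torsion, and either
(1) `E = E_S(S/XS)` and `E` is the ascending union of the submodules
`Ann_E(XⁿS)`, each factor `Ann_E(Xⁿ⁺¹S)/Ann_E(XⁿS)` being isomorphic as a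
`S/XS ≅ k[θ]`-module to the rational function field `k(θ)`; or
(2) `E = E_S(S/(XS + p(θ)S))` for some irreducible `p(θ) ∈ k[θ]`, and `E` is locally
finite dimensional over `k`. -/
theorem indecomposable_injective_torsion_classification
    {k : Type u} [Field k]
    {R : Type u} [CommRing R] [IsDomain R] [IsDiscreteValuationRing R] [Algebra k R]
    (X : R) (hX : IsLocalRing.maximalIdeal R = Ideal.span {X})
    (hres : Function.Bijective ((IsLocalRing.residue R).comp (algebraMap k R)))
    (α : R ≃ₐ[k] R) (hord : ∀ n : ℕ, 0 < n → α ^ n ≠ 1)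
    {S : Type u} [Ring S] (φ : R →+* S) (θ : S)
    (hS : IsSkewPolynomialRing α.toRingEquiv φ θ)
    {T : Type u} [Ring T] (ψ : S →+* T) (hT : IsLocalizationAt (φ X) ψ)
    (E : Type u) [AddCommGroup E] [Module Sᵐᵒᵖ E]
    (hinj : Module.Injective Sᵐᵒᵖ E)
    (hne : (⊥ : Submodule Sᵐᵒᵖ E) ≠ ⊤)
    (hindec : ∀ A B : Submodule Sᵐᵒᵖ E, IsCompl A B → A = ⊥ ∨ B = ⊥)
    (htor : ∃ e : E, e ≠ 0 ∧ ∃ n : ℕ, op (φ X ^ n) • e = 0) :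
    IsXTorsion (φ X) E ∧
    (((∃ f : rQuot S (φ X) →ₗ[Sᵐᵒᵖ] E, IsInjectiveHullVia Sᵐᵒᵖ f) ∧
      ∃ C : ℕ → Submodule Sᵐᵒᵖ E,
        (∀ (n : ℕ) (e : E), e ∈ C n ↔ op (φ X ^ n) • e = 0) ∧
        (⨆ n, C n) = ⊤ ∧
        ∀ n : ℕ,
          ∃ e : (↥(C (n + 1)) ⧸ Submodule.comap (C (n + 1)).subtype (C n)) ≃+ RatFunc k,
            (∀ (a : k) (m : ↥(C (n + 1)) ⧸ Submodule.comap (C (n + 1)).subtype (C n)),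
              e (op (φ (algebraMap k R a)) • m) = RatFunc.C a * e m) ∧
            (∀ m : ↥(C (n + 1)) ⧸ Submodule.comap (C (n + 1)).subtype (C n),
              e (op θ • m) = RatFunc.X * e m)) ∨
     (∃ p : Polynomial k, Irreducible p ∧
        (∃ f : rQuot2 S (φ X) (thetaPoly φ θ p) →ₗ[Sᵐᵒᵖ] E, IsInjectiveHullVia Sᵐᵒᵖ f) ∧
        ∀ N : Submodule Sᵐᵒᵖ E, N.FG → FinDimOver k φ ↥N)) := by
  have F := skFacts X hX hres hS
  have hU : SFacts.Unif S E := by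
    intro e f he hf
    by_contra hcon
    push Not at hcon
    have hd : Disjoint (Submodule.span Sᵐᵒᵖ {e}) (Submodule.span Sᵐᵒᵖ {f}) := by
      rw [Submodule.disjoint_def]
      intro y hy hz
      obtain ⟨s, rfl⟩ := Submodule.mem_span_singleton.1 hy
      obtain ⟨t, ht⟩ := Submodule.mem_span_singleton.1 hz
      exact hcon s.unop t.unop ht.symm
    rcases aux_uniform hinj hindec _ _ hd with h | h
    · exact he (Submodule.span_singleton_eq_bot.1 h)
    · exact hf (Submodule.span_singleton_eq_bot.1 h)
  obtain ⟨⟨a, ha, ha0⟩, htors⟩ := F.torsion hU htor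
  refine ⟨htors, ?_⟩
  by_cases hcase : ∃ b ∈ F.annC E 1, b ≠ 0 ∧ ∃ p : Polynomial k, p ≠ 0 ∧ op (skEta hS p) • b = 0
  · right
    obtain ⟨b, hb, hb0, p, hp, hpb⟩ := hcase
    obtain ⟨q, hq, c, hc, hc0, hqc⟩ := F.irr hp hb hb0 hpb
    refine ⟨q, hq, ?_, ?_⟩
    · rw [← skEta_apply hS]
      exact F.hull2 hinj hU hq hc hc0 hqc
    · let _ : Module k E := Module.compHom E (opScalars φ)
      refine finDim_of_span (φ := φ) (fun _ _ => rfl) (fun e => ?_)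
      obtain ⟨n, hn⟩ := htors e
      exact F.fd (fun d e => by rw [skEta_C]; rfl) hU hc hc0 hq.ne_zero hqc n e hn
  · left
    push Not at hcase
    refine ⟨F.hull1 hinj hU ha ha0 fun p h => ?_, F.annC E, fun n e => Iff.rfl, ?_, fun n => ?_⟩
    · by_contra hp
      exact hcase a ha ha0 p hp h
    · rw [eq_top_iff]
      intro e _
      obtain ⟨n, hn⟩ := htors e
      exact Submodule.mem_iSup_of_mem n hn
    · obtain ⟨e, he⟩ := F.factor hinj hU ha ha0 (fun p b hb hp h => by
        by_contra hb0
        exact hcase b hb hb0 p hp h) n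
      refine ⟨e, fun c m => ?_, fun m => ?_⟩
      · rw [← skEta_C hS, he, RatFunc.algebraMap_C]
      · have := he Polynomial.X m
        rwa [skEta_X, RatFunc.algebraMap_X] at this
end

section
/- Let V be a simple right S-module. Then: (1) V is faithful if and only if V is 𝒳-torsion free; (2) if V is 𝒳-torsion free, then the S-module structure of V extends to a structure of (necessarily simple) right T-module. -/
open MulOpposite

universe u

section Helpers

variable {S : Type u} [Ring S]

/-- `x` is a normal element. -/
def HNormal (x : S) : Prop :=
  (∀ s : S, ∃ s' : S, s * x = x * s') ∧ (∀ s : S, ∃ s' : S, x * s = s' * x)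

theorem HNormal.pow {x : S} (h : HNormal x) (n : ℕ) : ∀ s : S, ∃ s' : S, s * x ^ n = x ^ n * s' := by
  induction n with
  | zero => intro s; exact ⟨s, by simp⟩
  | succ n ih =>
    intro s
    obtain ⟨s1, h1⟩ := ih s
    obtain ⟨s2, h2⟩ := h.1 s1
    exact ⟨s2, by rw [pow_succ, ← mul_assoc, h1, mul_assoc, h2, mul_assoc]⟩

theorem HNormal.zero_or_bij {x : S} (h : HNormal x) (V : Type u) [AddCommGroup V] [Module Sᵐᵒᵖ V]
    (hV : IsSimpleModule Sᵐᵒᵖ V) :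
    (∀ v : V, op x • v = 0) ∨ Function.Bijective (fun v : V => op x • v) := by
  let K : Submodule Sᵐᵒᵖ V :=
    { carrier := {v | op x • v = 0}
      add_mem' := by
        intro a b ha hb
        simp only [Set.mem_ofPred_eq] at *
        rw [smul_add, ha, hb, add_zero]
      zero_mem' := by simp
      smul_mem' := by
        intro c v hv
        simp only [Set.mem_ofPred_eq] at *
        obtain ⟨s', hs⟩ := h.1 c.unop
        have : op x * c = op s' * op x := by
          rw [← op_mul, ← hs]; rfl
        rw [← mul_smul, this, mul_smul, hv, smul_zero] }
  let I : Submodule Sᵐᵒᵖ V :=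
    { carrier := Set.range (fun v : V => op x • v)
      add_mem' := by
        rintro _ _ ⟨a, rfl⟩ ⟨b, rfl⟩
        exact ⟨a + b, by simp⟩
      zero_mem' := ⟨0, by simp⟩
      smul_mem' := by
        rintro c _ ⟨v, rfl⟩
        obtain ⟨s', hs⟩ := h.2 c.unop
        have : c * op x = op x * op s' := by
          rw [← op_mul, ← hs]; rfl
        refine ⟨op s' • v, ?_⟩
        simp only
        rw [← mul_smul, ← this, mul_smul] }
  rcases eq_bot_or_eq_top K with hK | hK
  · rcases eq_bot_or_eq_top I with hI | hI
    · left
      intro v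
      have : op x • v ∈ I := ⟨v, rfl⟩
      rwa [hI, Submodule.mem_bot] at this
    · right
      constructor
      · intro a b hab
        have : a - b ∈ K := by
          show op x • (a - b) = 0
          rw [smul_sub]; exact sub_eq_zero.2 hab
        rw [hK, Submodule.mem_bot] at this
        exact sub_eq_zero.1 this
      · intro v
        have : v ∈ I := by rw [hI]; trivial
        exact this
  · left
    intro v
    have : v ∈ K := by rw [hK]; trivial
    exact this

theorem pow_bij {x : S} (V : Type u) [AddCommGroup V] [Module Sᵐᵒᵖ V]
    (hb : Function.Bijective (fun v : V => op x • v)) (n : ℕ) :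
    Function.Bijective (fun v : V => op (x ^ n) • v) := by
  induction n with
  | zero =>
    simp only [pow_zero, op_one, one_smul]
    exact Function.bijective_id
  | succ n ih =>
    have : (fun v : V => op (x ^ (n + 1)) • v) = (fun v : V => op x • v) ∘ fun v => op (x ^ n) • v := by
      funext v
      simp only [Function.comp]
      rw [← mul_smul, ← op_mul, pow_succ]
    rw [this]
    exact hb.comp ih

/-- Extending the module structure to the localization. -/
theorem extend_struct {x : S} (h : HNormal x) {T : Type u} [Ring T] (ψ : S →+* T)
    (hT : IsLocalizationAt x ψ) (V : Type u) [AddCommGroup V] [Module Sᵐᵒᵖ V]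
    (hV : IsSimpleModule Sᵐᵒᵖ V) (hb : Function.Bijective (fun v : V => op x • v)) :
    ∃ (W : Type u) (_ : AddCommGroup W) (_ : Module Tᵐᵒᵖ W) (e : V ≃+ W),
        (∀ (s : S) (v : V), e (op s • v) = op (ψ s) • e v) ∧ IsSimpleModule Tᵐᵒᵖ W := by
  have hbn := pow_bij V hb
  have hex : ∀ (t : T) (v : V), ∃ w : V, ∀ (s : S) (n : ℕ), t * ψ x ^ n = ψ s →
      op (x ^ n) • w = op s • v := by
    intro t v
    obtain ⟨s0, n0, h0⟩ := hT.surj t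
    obtain ⟨w, hw⟩ := (hbn n0).2 (op s0 • v)
    simp only at hw
    refine ⟨w, fun s n hs => ?_⟩
    have e1 : s * x ^ n0 = s0 * x ^ n := by
      apply hT.inj
      rw [map_mul, map_mul, map_pow, map_pow, ← hs, ← h0, mul_assoc, mul_assoc, ← pow_add,
        ← pow_add, add_comm]
    apply (hbn n0).1
    simp only
    rw [← mul_smul, ← mul_smul, ← op_mul, ← op_mul, e1, ← pow_add, add_comm, pow_add, op_mul,
      mul_smul, hw, ← mul_smul, op_mul]
  choose f hf using hex
  have huniq : ∀ (t : T) (v w : V) (s : S) (n : ℕ), t * ψ x ^ n = ψ s →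
      op (x ^ n) • w = op s • v → f t v = w := by
    intro t v w s n hs hw
    apply (hbn n).1
    simp only
    rw [hw, hf t v s n hs]
  have hfS : ∀ (s : S) (v : V), f (ψ s) v = op s • v := by
    intro s v
    exact huniq _ _ _ s 0 (by simp) (by simp)
  have hfadd : ∀ t v w, f t (v + w) = f t v + f t w := by
    intro t v w
    obtain ⟨s, n, hs⟩ := hT.surj t
    refine huniq _ _ _ s n hs ?_
    rw [smul_add, smul_add, hf t v s n hs, hf t w s n hs]
  have hfadd' : ∀ t t' v, f (t + t') v = f t v + f t' v := by
    intro t t' v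
    obtain ⟨s, n, hs⟩ := hT.surj t
    obtain ⟨s', n', hs'⟩ := hT.surj t'
    refine huniq _ _ _ (s * x ^ n' + s' * x ^ n) (n + n') ?_ ?_
    · rw [add_mul, map_add, map_mul, map_mul, ← hs, ← hs', map_pow, map_pow, mul_assoc, mul_assoc,
        ← pow_add, ← pow_add, add_comm n' n]
    · rw [smul_add, op_add, add_smul, op_mul, op_mul, mul_smul, mul_smul, ← hf t v s n hs,
        ← hf t' v s' n' hs', ← mul_smul, ← mul_smul, ← op_mul, ← op_mul, ← pow_add, ← pow_add,
        add_comm n' n]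
  have hfmul : ∀ t t' v, f (t * t') v = f t' (f t v) := by
    intro t t' v
    obtain ⟨s, n, hs⟩ := hT.surj t
    obtain ⟨s', n', hs'⟩ := hT.surj t'
    obtain ⟨s2, h2⟩ := h.pow n s'
    refine huniq _ _ _ (s * s2) (n' + n) ?_ ?_
    · rw [pow_add, ← mul_assoc, mul_assoc t, hs', mul_assoc t, ← map_pow, ← map_mul, h2, map_mul,
        ← mul_assoc, map_pow, hs, map_mul]
    · rw [pow_add, op_mul, mul_smul, hf t' _ s' n' hs', ← mul_smul, ← op_mul, h2, op_mul,
        mul_smul, hf t v s n hs, ← mul_smul, op_mul]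
  let M : Module Tᵐᵒᵖ V :=
    { smul := fun t v => f t.unop v
      one_smul := fun v => by
        show f 1 v = v
        have := hfS 1 v
        simpa using this
      mul_smul := fun t t' v => hfmul t'.unop t.unop v
      smul_zero := fun t => by
        show f t.unop 0 = 0
        have := hfadd t.unop 0 0
        simpa using this
      zero_smul := fun v => by
        show f 0 v = 0
        have := hfS 0 v
        simpa using this
      smul_add := fun t v w => hfadd _ _ _
      add_smul := fun t t' v => hfadd' _ _ _ }
  refine ⟨V, inferInstance, M, AddEquiv.refl V, fun s v => (hfS s v).symm, ?_⟩
  rw [isSimpleModule_iff_toSpanSingleton_surjective] at hV ⊢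
  refine ⟨hV.1, fun m hm v => ?_⟩
  obtain ⟨c, hc⟩ := hV.2 m hm v
  refine ⟨op (ψ c.unop), ?_⟩
  exact (hfS c.unop m).trans hc

variable {R : Type u} [CommRing R] {a : R ≃+* R} {φ : R →+* S} {θ : S}

theorem skew_ind (hS : IsSkewPolynomialRing a φ θ) (P : S → Prop)
    (hadd : ∀ s t, P s → P t → P (s + t)) (hmul : ∀ s t, P s → P t → P (s * t))
    (hφ : ∀ r, P (φ r)) (hθ : P θ) (s : S) : P s := by
  obtain ⟨p, rfl⟩ := hS.bijective.2 s
  have hp : ∀ n : ℕ, P (θ ^ n) := by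
    intro n
    induction n with
    | zero => simpa using hφ 1
    | succ n ih => rw [pow_succ]; exact hmul _ _ ih hθ
  simp only [Finsupp.sum]
  refine Finset.sum_induction _ P hadd (by simpa using hφ 0) ?_
  intro i _
  exact hmul _ _ (hφ _) (hp i)

theorem theta_normal (hS : IsSkewPolynomialRing a φ θ) : HNormal θ := by
  constructor
  · refine skew_ind hS _ ?_ ?_ ?_ ?_
    · rintro s t ⟨s', hs⟩ ⟨t', ht⟩
      exact ⟨s' + t', by rw [add_mul, hs, ht, mul_add]⟩
    · rintro s t ⟨s', hs⟩ ⟨t', ht⟩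
      exact ⟨s' * t', by rw [mul_assoc, ht, ← mul_assoc, hs, mul_assoc]⟩
    · intro r
      exact ⟨φ (a.symm r), by rw [hS.commutes, a.apply_symm_apply]⟩
    · exact ⟨θ, rfl⟩
  · refine skew_ind hS _ ?_ ?_ ?_ ?_
    · rintro s t ⟨s', hs⟩ ⟨t', ht⟩
      exact ⟨s' + t', by rw [mul_add, hs, ht, add_mul]⟩
    · rintro s t ⟨s', hs⟩ ⟨t', ht⟩
      exact ⟨s' * t', by rw [← mul_assoc, hs, mul_assoc, ht, mul_assoc]⟩
    · intro r
      exact ⟨φ (a r), hS.commutes r⟩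
    · exact ⟨θ, rfl⟩

theorem X_normal (hS : IsSkewPolynomialRing a φ θ) {X : R} (h1 : X ∣ a X) (h2 : X ∣ a.symm X) :
    HNormal (φ X) := by
  constructor
  · refine skew_ind hS _ ?_ ?_ ?_ ?_
    · rintro s t ⟨s', hs⟩ ⟨t', ht⟩
      exact ⟨s' + t', by rw [add_mul, hs, ht, mul_add]⟩
    · rintro s t ⟨s', hs⟩ ⟨t', ht⟩
      exact ⟨s' * t', by rw [mul_assoc, ht, ← mul_assoc, hs, mul_assoc]⟩
    · intro r
      exact ⟨φ r, by rw [← map_mul, mul_comm, map_mul]⟩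
    · obtain ⟨c, hc⟩ := h1
      exact ⟨φ c * θ, by rw [hS.commutes, hc, map_mul, mul_assoc]⟩
  · refine skew_ind hS _ ?_ ?_ ?_ ?_
    · rintro s t ⟨s', hs⟩ ⟨t', ht⟩
      exact ⟨s' + t', by rw [mul_add, hs, ht, add_mul]⟩
    · rintro s t ⟨s', hs⟩ ⟨t', ht⟩
      exact ⟨s' * t', by rw [← mul_assoc, hs, mul_assoc, ht, mul_assoc]⟩
    · intro r
      exact ⟨φ r, by rw [← map_mul, mul_comm, map_mul]⟩
    · obtain ⟨d, hd⟩ := h2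
      have : X = a d * a X := by
        rw [← map_mul, mul_comm, ← hd, a.apply_symm_apply]
      exact ⟨φ (a d) * θ, by rw [mul_assoc, hS.commutes, ← mul_assoc, ← map_mul, ← this]⟩

theorem phi_inj (hS : IsSkewPolynomialRing a φ θ) {r : R} (h : φ r = 0) : r = 0 := by
  have h1 : (Finsupp.single 0 r : ℕ →₀ R) = 0 := by
    apply hS.bijective.1
    simp [h]
  simpa using h1

/-- A nonzero right annihilator contains a monomial. -/
theorem exists_monomial [IsDomain R] {k : Type u} [Field k] [Algebra k R] (α : R ≃ₐ[k] R)
    (hord : ∀ n : ℕ, 0 < n → α ^ n ≠ 1)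
    (hS : IsSkewPolynomialRing α.toRingEquiv φ θ) (P : S → Prop)
    (hsub : ∀ s t, P s → P t → P (s - t)) (hl : ∀ r s, P s → P (φ r * s))
    (hr : ∀ r s, P s → P (s * φ r)) (z : S) (hz : z ≠ 0) (hPz : P z) :
    ∃ (r : R) (n : ℕ), r ≠ 0 ∧ P (φ r * θ ^ n) := by
  classical
  set F : (ℕ →₀ R) → S := fun p : ℕ →₀ R => p.sum fun n r => φ r * θ ^ n with hF
  have hcomm : ∀ (n : ℕ) (r : R), θ ^ n * φ r = φ ((α ^ n) r) * θ ^ n := by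
    intro n
    induction n with
    | zero => intro r; simp
    | succ n ih =>
      intro r
      rw [pow_succ, mul_assoc, hS.commutes, ← mul_assoc, ih, mul_assoc, pow_succ α]
      rfl
  have hex : ∃ m : ℕ, ∃ p : ℕ →₀ R, p ≠ 0 ∧ P (F p) ∧ p.support.card = m := by
    obtain ⟨p, hp⟩ := hS.bijective.2 z
    refine ⟨_, p, ?_, ?_, rfl⟩
    · rintro rfl
      apply hz
      rw [← hp]; simp
    · have : F p = z := hp
      rwa [this]
  obtain ⟨p, hp0, hPp, hcard⟩ := Nat.find_spec hex
  have hmin : ∀ q : ℕ →₀ R, P (F q) → q.support.card < p.support.card → q = 0 := by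
    intro q hq hlt
    by_contra hne
    rw [hcard] at hlt
    exact Nat.find_min hex hlt ⟨q, hne, hq, rfl⟩
  obtain ⟨n, hn⟩ := Finsupp.support_nonempty_iff.2 hp0
  have key : ∀ (r : R) (i : ℕ), p i * (r - (α ^ i) ((α ^ n).symm r)) = 0 := by
    intro r
    let q : ℕ →₀ R := Finsupp.onFinset p.support
      (fun i => p i * (r - (α ^ i) ((α ^ n).symm r))) (by
        intro i hi
        rw [Finsupp.mem_support_iff]
        exact left_ne_zero_of_mul hi)
    have hq : F q = φ r * F p - F p * φ ((α ^ n).symm r) := by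
      have : F q = ∑ i ∈ p.support, φ (p i * (r - (α ^ i) ((α ^ n).symm r))) * θ ^ i := by
        simp only [hF]
        rw [Finsupp.onFinset_sum]
        intro i; simp
      rw [this]
      simp only [hF, Finsupp.sum]
      rw [Finset.mul_sum, Finset.sum_mul, ← Finset.sum_sub_distrib]
      refine Finset.sum_congr rfl fun i _ => ?_
      rw [mul_assoc (φ (p i)), hcomm, mul_sub, map_sub, sub_mul, map_mul, map_mul, ← mul_assoc,
        ← mul_assoc, ← map_mul, ← map_mul, ← map_mul, mul_comm r]
    have hq0 : q = 0 := by
      apply hmin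
      · rw [hq]
        exact hsub _ _ (hl _ _ hPp) (hr _ _ hPp)
      · apply Finset.card_lt_card
        rw [Finset.ssubset_iff_of_subset Finsupp.support_onFinset_subset]
        refine ⟨n, hn, ?_⟩
        rw [Finsupp.mem_support_iff, not_not]
        show p n * (r - (α ^ n) ((α ^ n).symm r)) = 0
        rw [AlgEquiv.apply_symm_apply, sub_self, mul_zero]
    intro i
    have := DFunLike.congr_fun hq0 i
    exact this
  have hlt : ∀ i j : ℕ, i < j → α ^ i ≠ α ^ j := by
    intro i j hij he
    apply hord (j - i) (by omega)
    have : α ^ i * α ^ (j - i) = α ^ i * 1 := by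
      rw [← pow_add, mul_one, he]; congr 1; omega
    exact mul_left_cancel this
  have hpi : ∀ i, i ≠ n → p i = 0 := by
    intro i hi
    by_contra hne
    have he : α ^ i = α ^ n := by
      ext r
      have := key ((α ^ n) r) i
      rw [AlgEquiv.symm_apply_apply] at this
      rcases mul_eq_zero.1 this with h | h
      · exact absurd h hne
      · exact (sub_eq_zero.1 h).symm
    rcases lt_or_gt_of_ne hi with h | h
    · exact hlt _ _ h he
    · exact hlt _ _ h he.symm
  have hps : p = Finsupp.single n (p n) := by
    ext i
    by_cases hi : i = n
    · subst hi; simp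
    · rw [hpi i hi, Finsupp.single_eq_of_ne hi]
  refine ⟨p n, n, Finsupp.mem_support_iff.1 hn, ?_⟩
  have : F p = φ (p n) * θ ^ n := by
    rw [hps]; simp [hF]
  rwa [← this]

end Helpers

/-- Let `V` be a simple right `S`-module.  Then (1) `V` is faithful
iff `V` is `𝒳`-torsion free; (2) if `V` is `𝒳`-torsion free then the `S`-module
structure of `V` extends to a structure of (necessarily simple) right `T`-module. -/
theorem faithful_iff_torsion_free_and_T_structure
    {k : Type u} [Field k]
    {R : Type u} [CommRing R] [IsDomain R] [IsDiscreteValuationRing R] [Algebra k R]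
    (X : R) (hX : IsLocalRing.maximalIdeal R = Ideal.span {X})
    (hres : Function.Bijective ((IsLocalRing.residue R).comp (algebraMap k R)))
    (α : R ≃ₐ[k] R) (hord : ∀ n : ℕ, 0 < n → α ^ n ≠ 1)
    {S : Type u} [Ring S] (φ : R →+* S) (θ : S)
    (hS : IsSkewPolynomialRing α.toRingEquiv φ θ)
    {T : Type u} [Ring T] (ψ : S →+* T) (hT : IsLocalizationAt (φ X) ψ)
    (V : Type u) [AddCommGroup V] [Module Sᵐᵒᵖ V] (hV : IsSimpleModule Sᵐᵒᵖ V) :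
    (FaithfulSMul Sᵐᵒᵖ V ↔ IsXTorsionFree (φ X) V) ∧
    (IsXTorsionFree (φ X) V →
      ∃ (W : Type u) (_ : AddCommGroup W) (_ : Module Tᵐᵒᵖ W) (e : V ≃+ W),
        (∀ (s : S) (v : V), e (op s • v) = op (ψ s) • e v) ∧ IsSimpleModule Tᵐᵒᵖ W) := by
  have hXmem : X ∈ IsLocalRing.maximalIdeal R := by
    rw [hX]; exact Ideal.mem_span_singleton_self X
  have hXu : ¬ IsUnit X := (IsLocalRing.mem_maximalIdeal X).1 hXmem
  have hdvd : ∀ y : R, ¬ IsUnit y → X ∣ y := by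
    intro y hy
    rw [← Ideal.mem_span_singleton, ← hX]
    exact (IsLocalRing.mem_maximalIdeal y).2 hy
  have hXirr : Irreducible X := (IsDiscreteValuationRing.irreducible_iff_uniformizer X).2 hX
  have hN : HNormal (φ X) := by
    refine X_normal hS (hdvd _ ?_) (hdvd _ ?_)
    · exact fun h => hXu ((MulEquiv.isUnit_map α.toRingEquiv).1 h)
    · exact fun h => hXu ((MulEquiv.isUnit_map α.toRingEquiv.symm).1 h)
  have hNθ : HNormal θ := theta_normal hS
  have hnt : Nontrivial V := IsSimpleModule.nontrivial Sᵐᵒᵖ V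
  have hbij : IsXTorsionFree (φ X) V → Function.Bijective (fun v : V => op (φ X) • v) := by
    intro h
    rcases hN.zero_or_bij V hV with h0 | h0
    · obtain ⟨v, hv⟩ := exists_ne (0 : V)
      exact absurd (h v 1 (by rw [pow_one]; exact h0 v)) hv
    · exact h0
  refine ⟨⟨?_, ?_⟩, fun h => extend_struct hN ψ hT V hV (hbij h)⟩
  · intro hf
    rcases hN.zero_or_bij V hV with h0 | h0
    · exfalso
      have : op (φ X) = (0 : Sᵐᵒᵖ) := by
        apply hf.eq_of_smul_eq_smul (α := V)
        intro v
        rw [h0 v, zero_smul]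
      rw [op_eq_zero_iff] at this
      exact hXirr.ne_zero (phi_inj hS this)
    · intro m n hm
      apply (pow_bij V h0 n).1
      simp only
      rw [hm, smul_zero]
  · intro h
    have hb := hbij h
    suffices H : ∀ z : S, (∀ v : V, op z • v = 0) → z = 0 by
      constructor
      intro c d hcd
      have := H (c.unop - d.unop) (by
        intro v
        rw [op_sub, op_unop, op_unop, sub_smul, hcd, sub_self])
      exact unop_injective (sub_eq_zero.1 this)
    have hunit : ∀ (u : R), IsUnit u → ∀ v : V, op (φ u) • v = 0 → v = 0 := by
      rintro _ ⟨u, rfl⟩ v hv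
      have : op (φ (u⁻¹ : Rˣ)) • op (φ (u : R)) • v = v := by
        rw [← mul_smul, ← op_mul, ← map_mul]; simp
      rw [← this, hv, smul_zero]
    obtain ⟨v, hv⟩ := exists_ne (0 : V)
    rcases hNθ.zero_or_bij V hV with hθ | hθ
    · exfalso
      obtain ⟨w, hw⟩ := hb.2 v
      simp only at hw
      obtain ⟨c, hc⟩ := ((isSimpleModule_iff_toSpanSingleton_surjective).1 hV).2 v hv w
      have hact : ∀ s : S, ∃ r : R, ∀ v : V, op s • v = op (φ r) • v := by
        refine skew_ind hS _ ?_ ?_ ?_ ?_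
        · rintro s t ⟨s', hs⟩ ⟨t', ht⟩
          exact ⟨s' + t', fun v => by rw [op_add, add_smul, hs, ht, map_add, op_add, add_smul]⟩
        · rintro s t ⟨s', hs⟩ ⟨t', ht⟩
          exact ⟨s' * t', fun v => by rw [op_mul, mul_smul, hs, ht, map_mul, op_mul, mul_smul]⟩
        · exact fun r => ⟨r, fun v => rfl⟩
        · exact ⟨0, fun v => by rw [hθ]; simp⟩
      obtain ⟨r, hr⟩ := hact c.unop
      have hc' : op (φ r) • v = w := by rw [← hr]; exact hc
      apply hv
      apply hunit (1 - r * X)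
      · by_contra hnu
        have h1 := hdvd _ hnu
        have h2 : X ∣ 1 := by
          have := dvd_add h1 (Dvd.intro_left r rfl)
          simpa using this
        exact hXu (isUnit_of_dvd_one h2)
      · rw [map_sub, map_one, op_sub, sub_smul, map_mul, op_mul, mul_smul, hc', hw]
        simp
    · intro z hz
      by_contra hne
      obtain ⟨r, n, hr0, hrn⟩ := exists_monomial α hord hS (fun s => ∀ v : V, op s • v = 0)
        (by intro s t hs ht v; rw [op_sub, sub_smul, hs, ht, sub_zero])
        (by intro r s hs v; rw [op_mul, mul_smul, hs])
        (by intro r s hs v; rw [op_mul, mul_smul, hs, smul_zero]) z hne hz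
      obtain ⟨m, u, hu⟩ := IsDiscreteValuationRing.eq_unit_mul_pow_irreducible hr0 hXirr
      apply hv
      apply hunit u u.isUnit
      apply (pow_bij V hb m).1
      apply (pow_bij V hθ n).1
      simp only
      rw [smul_zero, smul_zero, ← mul_smul, ← mul_smul, ← op_mul, ← op_mul, ← map_pow,
        ← mul_assoc, ← map_mul, ← hu]
      exact hrn v
end

section
/- (1) Let U be an 𝒳-torsion free right S-module. Then E_S(U) = E_T(U ⊗_S T); that is, the T-module E_T(U ⊗_S T) is, as an S-module, an injective hull of U. (2) If V is a faithful simple right S-module (so that V carries a T-module structure), then E_S(V) = E_T(V). -/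
open MulOpposite

universe u

/-- Injectivity descends along an Ore localization. -/
theorem injective_of_loc {A B : Type u} [Ring A] [Ring B] (ρ : A →+* B) (y : A)
    (hinj : Function.Injective ρ) (hu : IsUnit (ρ y))
    (hsurj : ∀ b : B, ∃ (a : A) (n : ℕ), ρ y ^ n * b = ρ a)
    (E : Type u) [AddCommGroup E] [Module A E] [Module B E]
    (hE : ∀ (a : A) (e : E), a • e = ρ a • e) (hBE : Module.Injective B E) :
    Module.Injective A E := by
  apply Module.Baer.injective
  intro I f
  have ore : ∀ (c : B) (n : ℕ), ∃ (s : A) (m : ℕ), ρ y ^ m * c = ρ s * ρ y ^ n := by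
    intro c n
    obtain ⟨v, hv⟩ := hu.pow n
    obtain ⟨s, m, h⟩ := hsurj (c * ↑v⁻¹)
    refine ⟨s, m, ?_⟩
    rw [← h, ← hv]
    simp [mul_assoc]
  have smul_zero' : ∀ (n : ℕ) (e : E), ρ y ^ n • e = 0 → e = 0 := by
    intro n e h
    exact ((hu.pow n).smul_eq_zero).1 h
  let G : Submodule B (B × E) :=
    { carrier := {p | ∃ (n : ℕ) (a : I), ρ y ^ n * p.1 = ρ a ∧ ρ y ^ n • p.2 = f a}
      zero_mem' := ⟨0, 0, by simp, by simp⟩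
      add_mem' := by
        rintro ⟨b, e⟩ ⟨b', e'⟩ ⟨n, a, h1, h2⟩ ⟨n', a', h1', h2'⟩
        refine ⟨n + n', y ^ n' • a + y ^ n • a', ?_, ?_⟩
        · simp only [Prod.fst_add, mul_add, Submodule.coe_add, Submodule.coe_smul, smul_eq_mul,
            map_add, map_mul, map_pow, ← h1, ← h1', ← mul_assoc, ← pow_add, add_comm n' n]
        · rw [map_add, map_smul, map_smul, hE, hE, ← h2, ← h2', map_pow, map_pow, ← mul_smul,
            ← mul_smul, ← pow_add, ← pow_add, add_comm n' n]
          exact smul_add _ _ _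
      smul_mem' := by
        rintro c ⟨b, e⟩ ⟨n, a, h1, h2⟩
        obtain ⟨s, m, h⟩ := ore c n
        refine ⟨m, s • a, ?_, ?_⟩
        · change ρ y ^ m * (c * b) = _
          rw [← mul_assoc, h, mul_assoc, h1]
          simp
        · change ρ y ^ m • (c • e) = _
          rw [← mul_smul, h, mul_smul, h2, map_smul, hE] }
  have hG : ∀ p ∈ G, p.1 = 0 → p.2 = 0 := by
    rintro ⟨b, e⟩ ⟨n, a, h1, h2⟩ hb
    have hb : b = 0 := hb
    subst hb
    have ha : a = 0 := by
      apply Subtype.ext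
      apply hinj
      simpa using h1.symm
    subst ha
    apply smul_zero' n
    simpa using h2
  have hmem : ∀ a : I, ((ρ a, f a) : B × E) ∈ G := fun a => ⟨0, a, by simp, by simp⟩
  obtain ⟨g, hg⟩ := Module.Baer.of_injective hBE G.toLinearPMap.domain G.toLinearPMap.toFun
  refine ⟨LinearMap.toSpanSingleton A E (g 1), ?_⟩
  intro x hx
  have hd : ρ x ∈ G.toLinearPMap.domain := by
    change ρ x ∈ G.map (LinearMap.fst B B E)
    exact ⟨_, hmem ⟨x, hx⟩, rfl⟩
  have h1 := hg _ hd
  have h2 := Submodule.mem_graph_toLinearPMap hG ⟨ρ x, hd⟩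
  have h3 := hG _ (G.sub_mem h2 (hmem ⟨x, hx⟩)) (by simp)
  rw [LinearMap.toSpanSingleton_apply, hE, ← map_smul, smul_eq_mul, mul_one, h1]
  exact sub_eq_zero.1 h3

/-- Essentiality descends along an Ore localization. -/
theorem essential_of_loc {A B : Type u} [Ring A] [Ring B] (ρ : A →+* B) (y : A)
    (hu : IsUnit (ρ y))
    (hsurj : ∀ b : B, ∃ (a : A) (n : ℕ), ρ y ^ n * b = ρ a)
    {U U' E : Type u} [AddCommGroup U] [Module A U] [AddCommGroup U'] [Module B U']
    [AddCommGroup E] [Module A E] [Module B E]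
    (hE : ∀ (a : A) (e : E), a • e = ρ a • e)
    (η : U →+ U') (hη : ∀ (a : A) (u : U), η (a • u) = ρ a • η u)
    (hη' : ∀ u' : U', ∃ (u : U) (n : ℕ), ρ y ^ n • u' = η u)
    (g : U' →ₗ[B] E) (hg : IsEssentialSubmodule (LinearMap.range g))
    (W : Submodule A E) (hW : W ≠ ⊥) :
    ∃ x : E, x ≠ 0 ∧ x ∈ W ∧ x ∈ Set.range (g.toAddMonoidHom.comp η) := by
  obtain ⟨w, hw, hw0⟩ := Submodule.exists_mem_ne_zero_of_ne_bot hW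
  have h1 : Submodule.span B {w} ≠ ⊥ := by simpa using hw0
  obtain ⟨z, ⟨hz, ⟨u', rfl⟩⟩, hz0⟩ := Submodule.exists_mem_ne_zero_of_ne_bot (hg _ h1)
  obtain ⟨c, hc⟩ := Submodule.mem_span_singleton.1 hz
  obtain ⟨u, n, hun⟩ := hη' u'
  obtain ⟨a, m, ham⟩ := hsurj (ρ y ^ n * c)
  have key : a • w = ρ y ^ m • ρ y ^ n • g u' := by
    rw [hE, ← ham, mul_smul, mul_smul, hc]
  refine ⟨a • w, ?_, W.smul_mem _ hw, y ^ m • u, ?_⟩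
  · rw [key]
    intro h
    exact hz0 (((hu.pow n).smul_eq_zero).1 (((hu.pow m).smul_eq_zero).1 h))
  · change g (η (y ^ m • u)) = _
    rw [key, hη, ← hun, map_smul, map_smul, map_pow]

/-- (1) If `U` is an `𝒳`-torsion free right `S`-module then
`E_S(U) = E_T(U ⊗_S T)`: whenever `η : U → U'` exhibits the right `T`-module `U'` as
`U ⊗_S T` and `g : U' →ₗ[T] E` exhibits `E` as `E_T(U')`, the composite exhibits `E`,
viewed as an `S`-module by restriction, as an injective hull of `U` over `S`.
(2) If `V` is a faithful simple right `S`-module (with its `T`-module structure), then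
`E_S(V) = E_T(V)`: every injective hull of `V` over `T` is an injective hull over `S`. -/
theorem injective_hulls_over_S_and_T
    {k : Type u} [Field k]
    {R : Type u} [CommRing R] [IsDomain R] [IsDiscreteValuationRing R] [Algebra k R]
    (X : R) (hX : IsLocalRing.maximalIdeal R = Ideal.span {X})
    (hres : Function.Bijective ((IsLocalRing.residue R).comp (algebraMap k R)))
    (α : R ≃ₐ[k] R) (hord : ∀ n : ℕ, 0 < n → α ^ n ≠ 1)
    {S : Type u} [Ring S] (φ : R →+* S) (θ : S)
    (hS : IsSkewPolynomialRing α.toRingEquiv φ θ)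
    {T : Type u} [Ring T] (ψ : S →+* T) (hT : IsLocalizationAt (φ X) ψ) :
    (∀ (U : Type u) [AddCommGroup U] [Module Sᵐᵒᵖ U], IsXTorsionFree (φ X) U →
      ∀ (U' : Type u) [AddCommGroup U'] [Module Tᵐᵒᵖ U'] (η : U →+ U'),
        (∀ (s : S) (u : U), η (op s • u) = op (ψ s) • η u) →
        Function.Injective η →
        (∀ u' : U', ∃ (u : U) (n : ℕ), op (ψ (φ X) ^ n) • u' = η u) →
        ∀ (E : Type u) [AddCommGroup E] [Module Tᵐᵒᵖ E] (g : U' →ₗ[Tᵐᵒᵖ] E),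
          IsInjectiveHullVia Tᵐᵒᵖ g →
          letI : Module Sᵐᵒᵖ E := restrictOp ψ E
          IsInjectiveHullViaAdd Sᵐᵒᵖ (g.toAddMonoidHom.comp η)) ∧
    (∀ (V : Type u) [AddCommGroup V] [Module Tᵐᵒᵖ V],
      (letI : Module Sᵐᵒᵖ V := restrictOp ψ V
       IsSimpleModule Sᵐᵒᵖ V ∧ FaithfulSMul Sᵐᵒᵖ V) →
      ∀ (E : Type u) [AddCommGroup E] [Module Tᵐᵒᵖ E] (g : V →ₗ[Tᵐᵒᵖ] E),
        IsInjectiveHullVia Tᵐᵒᵖ g →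
        letI : Module Sᵐᵒᵖ V := restrictOp ψ V
        letI : Module Sᵐᵒᵖ E := restrictOp ψ E
        IsInjectiveHullViaAdd Sᵐᵒᵖ g.toAddMonoidHom) := by
  have hinj : Function.Injective (RingHom.op ψ) := by
    intro a b h
    exact unop_injective (hT.inj (op_injective h))
  have hu : IsUnit ((RingHom.op ψ) (op (φ X))) := hT.unit.op
  have hsurj : ∀ b : Tᵐᵒᵖ, ∃ (a : Sᵐᵒᵖ) (n : ℕ),
      (RingHom.op ψ) (op (φ X)) ^ n * b = (RingHom.op ψ) a := by
    intro b
    obtain ⟨s, n, h⟩ := hT.surj (unop b)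
    exact ⟨op s, n, unop_injective h⟩
  constructor
  · intro U _ _ _ U' _ _ η hη hηi hη' E _ _ g hg
    letI : Module Sᵐᵒᵖ E := restrictOp ψ E
    have hE : ∀ (a : Sᵐᵒᵖ) (e : E), a • e = (RingHom.op ψ) a • e := fun _ _ => rfl
    refine ⟨injective_of_loc _ _ hinj hu hsurj E hE hg.1, hg.2.1.comp hηi, ?_, ?_⟩
    · intro a u
      change g (η (a • u)) = (RingHom.op ψ) a • g (η u)
      rw [← map_smul]
      exact congrArg g (hη (unop a) u)
    · exact essential_of_loc _ _ hu hsurj hE η (fun a u => hη (unop a) u) hη' g hg.2.2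
  · intro V _ _ _ E _ _ g hg
    letI : Module Sᵐᵒᵖ V := restrictOp ψ V
    letI : Module Sᵐᵒᵖ E := restrictOp ψ E
    have hE : ∀ (a : Sᵐᵒᵖ) (e : E), a • e = (RingHom.op ψ) a • e := fun _ _ => rfl
    refine ⟨injective_of_loc _ _ hinj hu hsurj E hE hg.1, hg.2.1, ?_, ?_⟩
    · intro a u
      exact map_smul g ((RingHom.op ψ) a) u
    · exact essential_of_loc _ _ hu hsurj hE (AddMonoidHom.id V) (fun a u => rfl)
        (fun u' => ⟨u', 0, by simp⟩) g hg.2.2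
end
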